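/- arXiv:1310.6718 — 3 statements merged into one kernel-verified Lean document; each statement's English description precedes it below -/
import Mathlib

section
/- Let b be a nontrivial real beamsplitter, i.e. b = [[α, β],[β, −α]] with α, β ∈ ℝ, α² + β² = 1, α ≠ 0 and β ≠ 0. Then the subgroup of the orthogonal group O(3) generated by the three matrices b₁₂, b₁₃, b₂₃ (obtained by applying b to each pair of the three coordinates and the identity on the remaining coordinate) is dense in O(3); equivalently, its topological closure is all of O(3). -/
open scoped RealInnerProductSpace

theorem norm_eq_one_and_add_inv_eq_of_pow_eq_one {z : ℂ} {m : ℕ} (hm : m ≠ 0) (h : z ^ m = 1) :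
    ‖z‖ = 1 ∧ z + z⁻¹ = ((2 * z.re : ℝ) : ℂ) := by
  have h1 : ‖z‖ = 1 := Complex.norm_eq_one_of_pow_eq_one h hm
  refine ⟨h1, ?_⟩
  rw [Complex.inv_eq_conj h1, Complex.add_conj]

theorem exists_rootOfUnity_of_arccos_rational {a : ℝ} (h0 : -1 ≤ a) (h1 : a ≤ 1)
    (h : ∃ m : ℕ, m ≠ 0 ∧ ∃ n : ℤ, m * Real.arccos a = n * Real.pi) :
    ∃ z : ℂ, ∃ k : ℕ, k ≠ 0 ∧ z ^ k = 1 ∧ z + z⁻¹ = ((2 * a : ℝ) : ℂ) := by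
  obtain ⟨m, hm, n, hn⟩ := h
  refine ⟨Complex.exp (Real.arccos a * Complex.I), 2 * m, by omega, ?_, ?_⟩
  · rw [← Complex.exp_nat_mul, Complex.exp_eq_one_iff]
    refine ⟨n, ?_⟩
    have : (m : ℂ) * (Real.arccos a : ℂ) = n * (Real.pi : ℂ) := by exact_mod_cast hn
    push_cast
    linear_combination 2 * Complex.I * this
  · rw [← Complex.exp_neg, ← neg_mul, ← Complex.two_cos, ← Complex.ofReal_cos,
      Real.cos_arccos h0 h1]
    push_cast; rfl

theorem eq_of_rootOfUnity_cosines_add_eq_one {a b : ℝ} (hab : a + b = 1) (h : 0 < a * b)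
    {z w : ℂ} {k l : ℕ} (hk : k ≠ 0) (hl : l ≠ 0) (hz : z ^ k = 1) (hw : w ^ l = 1)
    (hza : z + z⁻¹ = ((2 * a : ℝ) : ℂ)) (hwb : w + w⁻¹ = ((2 * b : ℝ) : ℂ)) : a = b := by
  have hzi : IsIntegral ℤ z := IsIntegral.of_pow (Nat.pos_of_ne_zero hk) (hz ▸ isIntegral_one)
  have hwi : IsIntegral ℤ w := IsIntegral.of_pow (Nat.pos_of_ne_zero hl) (hw ▸ isIntegral_one)
  let K := IntermediateField.adjoin ℚ ({z, w} : Set ℂ)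
  have hfin : FiniteDimensional ℚ K := by
    apply IntermediateField.finiteDimensional_adjoin
    rintro x (rfl | rfl)
    · exact hzi.tower_top
    · exact hwi.tower_top
  have : NumberField K := ⟨⟩
  have hzK : z ∈ K := IntermediateField.subset_adjoin _ _ (by simp)
  have hwK : w ∈ K := IntermediateField.subset_adjoin _ _ (by simp)
  let Z : K := ⟨z, hzK⟩
  let W : K := ⟨w, hwK⟩
  have hZ : Z ^ k = 1 := Subtype.ext hz
  have hW : W ^ l = 1 := Subtype.ext hw
  have hZi : IsIntegral ℤ Z := IsIntegral.of_pow (Nat.pos_of_ne_zero hk) (hZ ▸ isIntegral_one)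
  have hWi : IsIntegral ℤ W := IsIntegral.of_pow (Nat.pos_of_ne_zero hl) (hW ▸ isIntegral_one)
  have hZi' : IsIntegral ℤ Z⁻¹ :=
    IsIntegral.of_pow (Nat.pos_of_ne_zero hk) (by rw [inv_pow, hZ, inv_one]; exact isIntegral_one)
  have hWi' : IsIntegral ℤ W⁻¹ :=
    IsIntegral.of_pow (Nat.pos_of_ne_zero hl) (by rw [inv_pow, hW, inv_one]; exact isIntegral_one)
  have hsum : Z + Z⁻¹ + (W + W⁻¹) = 2 := by
    apply Subtype.ext
    change z + z⁻¹ + (w + w⁻¹) = 2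
    rw [hza, hwb]
    norm_cast
    linarith
  have hprod : (((Z + Z⁻¹) * (W + W⁻¹) : K) : ℂ) = ((4 * (a * b) : ℝ) : ℂ) := by
    change (z + z⁻¹) * (w + w⁻¹) = _
    rw [hza, hwb]
    push_cast; ring
  have hne : (Z + Z⁻¹) * (W + W⁻¹) ≠ 0 := by
    intro h0
    rw [h0] at hprod
    have : (0 : ℝ) = 4 * (a * b) := Complex.ofReal_injective hprod
    linarith
  obtain ⟨n, hn, hpow⟩ := NumberField.Embeddings.pow_eq_one_of_norm_le_one K ℂ hne
    ((hZi.add hZi').mul (hWi.add hWi')) (by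
      intro φ
      obtain ⟨hnz, hrz⟩ := norm_eq_one_and_add_inv_eq_of_pow_eq_one hk (z := φ Z)
        (by rw [← map_pow, hZ, map_one])
      obtain ⟨hnw, hrw⟩ := norm_eq_one_and_add_inv_eq_of_pow_eq_one hl (z := φ W)
        (by rw [← map_pow, hW, map_one])
      have hs := congrArg φ hsum
      rw [map_mul, map_add, map_add, map_inv₀, map_inv₀]
      rw [map_add, map_add, map_add, map_inv₀, map_inv₀, hrz, hrw, map_ofNat] at hs
      have hs' : 2 * (φ Z).re + 2 * (φ W).re = 2 := by exact_mod_cast hs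
      rw [hrz, hrw, ← Complex.ofReal_mul, Complex.norm_real, Real.norm_eq_abs, abs_le]
      have h1 := Complex.re_le_norm (φ Z)
      have h2 := Complex.re_le_norm (φ W)
      rw [hnz] at h1
      rw [hnw] at h2
      have e : (φ W).re = 1 - (φ Z).re := by linarith
      rw [e] at h2 ⊢
      constructor <;> nlinarith [sq_nonneg (2 * (φ Z).re - 1)])
  have hp := congrArg (fun x : K => (x : ℂ)) hpow
  have hp' : (((Z + Z⁻¹) * (W + W⁻¹) : K) : ℂ) ^ n = 1 := by exact_mod_cast hp
  rw [hprod] at hp'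
  have hp2 : (4 * (a * b)) ^ n = 1 := by exact_mod_cast hp'
  have h4 : 4 * (a * b) = 1 := (pow_eq_one_iff_of_nonneg (by linarith) hn.ne').1 hp2
  have : (a - b) ^ 2 = 0 := by nlinarith
  linarith [pow_eq_zero_iff two_ne_zero |>.1 this]

section ReflectionClosed

variable {E : Type*} [NormedAddCommGroup E] [InnerProductSpace ℝ E] {S : Set E}

theorem neg_mem_of_reflection_closed
    (hrefl : ∀ v ∈ S, ∀ w ∈ S, w - (2 * ⟪v, w⟫) • v ∈ S) {v : E} (hv : ‖v‖ = 1) (hvS : v ∈ S) :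
    -v ∈ S := by
  have h := hrefl v hvS v hvS
  rw [real_inner_self_eq_norm_sq, hv] at h
  convert h using 1
  module

theorem circle_subset_or_arccos_rational (hS : IsClosed S)
    (hrefl : ∀ v ∈ S, ∀ w ∈ S, w - (2 * ⟪v, w⟫) • v ∈ S)
    {v v' : E} (hv : ‖v‖ = 1) (hv' : ‖v'‖ = 1) (hvv' : ⟪v, v'⟫ = 0) (hvS : v ∈ S) {φ : ℝ}
    (hφ : Real.cos φ • v + Real.sin φ • v' ∈ S) :
    (∀ θ : ℝ, Real.cos θ • v + Real.sin θ • v' ∈ S) ∨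
      ∃ m : ℕ, m ≠ 0 ∧ ∃ n : ℤ, m * φ = n * Real.pi := by
  let e : ℝ → E := fun θ => Real.cos θ • v + Real.sin θ • v'
  have he_inner (a b : ℝ) : ⟪e a, e b⟫ = Real.cos (a - b) := by
    simp only [e, inner_add_left, inner_add_right, real_inner_smul_left, real_inner_smul_right,
      real_inner_self_eq_norm_sq, hv, hv', hvv', real_inner_comm v v', Real.cos_sub]
    ring
  have he_norm (a : ℝ) : ‖e a‖ = 1 := by
    have h := he_inner a a
    rw [real_inner_self_eq_norm_sq, sub_self, Real.cos_zero] at h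
    exact (pow_eq_one_iff_of_nonneg (norm_nonneg _) two_ne_zero).1 h
  have he_pi (a : ℝ) : e (a + Real.pi) = -e a := by
    simp only [e, Real.cos_add_pi, Real.sin_add_pi]; module
  have hrot {a b : ℝ} (ha : e a ∈ S) (hb : e b ∈ S) : e (2 * a - b) ∈ S := by
    have h1 : ⟪e a, e b⟫ = Real.cos (a - b) := he_inner a b
    have h2 := hrefl _ ha _ hb
    have h3 : e b - (2 * ⟪e a, e b⟫) • e a = -e (2 * a - b) := by
      rw [h1]
      have hc : Real.cos (2 * a - b) = 2 * Real.cos (a - b) * Real.cos a - Real.cos b := by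
        have h2a : 2 * a - b = (a - b) + a := by ring
        have hb : Real.cos b = Real.cos a * Real.cos (a - b) + Real.sin a * Real.sin (a - b) := by
          rw [← Real.cos_sub, sub_sub_cancel]
        rw [h2a, Real.cos_add]
        linear_combination hb
      have hs : Real.sin (2 * a - b) = 2 * Real.cos (a - b) * Real.sin a - Real.sin b := by
        have h2a : 2 * a - b = (a - b) + a := by ring
        have hb : Real.sin b = Real.sin a * Real.cos (a - b) - Real.cos a * Real.sin (a - b) := by
          rw [← Real.sin_sub, sub_sub_cancel]
        rw [h2a, Real.sin_add]
        linear_combination hb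
      simp only [e, hc, hs]
      module
    have h4 : ‖-e (2 * a - b)‖ = 1 := by rw [norm_neg, he_norm]
    rw [h3] at h2
    simpa using neg_mem_of_reflection_closed hrefl h4 h2
  have h0 : e 0 ∈ S := by simpa [e] using hvS
  have hneg {t : ℝ} (ht : e t ∈ S) : e (-t) ∈ S := by simpa using hrot h0 ht
  have hcont : Continuous e := by fun_prop
  let T : AddSubgroup ℝ :=
    { carrier := {θ | ∀ t, e t ∈ S → e (t + θ) ∈ S}
      zero_mem' := fun t ht => by simpa using ht
      add_mem' := fun {a b} ha hb t ht => by
        rw [← add_assoc]; exact hb _ (ha _ ht)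
      neg_mem' := fun {a} ha t ht => by
        have := hneg (ha _ (hneg ht))
        rwa [neg_add, neg_neg] at this }
  have hTclosed : IsClosed (T : Set ℝ) := by
    change IsClosed {θ | ∀ t, e t ∈ S → e (t + θ) ∈ S}
    simp only [Set.ofPred_forall]
    exact isClosed_iInter fun t => isClosed_iInter fun _ =>
      hS.preimage (hcont.comp (continuous_const.add continuous_id))
  have hTφ : 2 * φ ∈ T := fun t ht => by
    have := hrot hφ (hneg ht)
    rwa [sub_neg_eq_add, add_comm] at this
  have hTpi : Real.pi ∈ T := fun t ht => by
    rw [he_pi]; exact neg_mem_of_reflection_closed hrefl (he_norm t) ht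
  rcases AddSubgroup.dense_or_cyclic T with hd | ⟨a, ha⟩
  · left
    intro θ
    have hθ : θ ∈ (T : Set ℝ) := by rw [hTclosed.closure_eq.symm, hd.closure_eq]; trivial
    have := hθ 0 h0
    rwa [zero_add] at this
  · right
    rw [ha, AddSubgroup.mem_closure_singleton] at hTφ hTpi
    obtain ⟨p, hp⟩ := hTφ
    obtain ⟨q, hq⟩ := hTpi
    rw [zsmul_eq_mul] at hp hq
    have hq0 : q ≠ 0 := by
      rintro rfl
      simp [Real.pi_ne_zero.symm] at hq
    refine ⟨(2 * q).natAbs, by omega, (2 * q).sign * p, ?_⟩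
    have h1 : (((2 * q).natAbs : ℤ) : ℝ) = (((2 * q).sign * (2 * q) : ℤ) : ℝ) := by
      rw [Int.sign_mul_self_eq_natAbs]
    rw [Int.cast_natCast] at h1
    rw [h1, ← hq]
    push_cast
    linear_combination -((2 * q).sign : ℝ) * q * hp

theorem exists_cos_sin_eq {x y : ℝ} (h : x ^ 2 + y ^ 2 = 1) :
    ∃ θ : ℝ, Real.cos θ = x ∧ Real.sin θ = y := by
  have hn : ‖(⟨x, y⟩ : ℂ)‖ = 1 := by
    rw [Complex.norm_def, Complex.normSq_mk, ← sq, ← sq, h, Real.sqrt_one]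
  refine ⟨Complex.arg ⟨x, y⟩, ?_, ?_⟩
  · have := Complex.norm_mul_cos_arg ⟨x, y⟩
    rwa [hn, one_mul] at this
  · have := Complex.norm_mul_sin_arg ⟨x, y⟩
    rwa [hn, one_mul] at this

theorem sphere_subset_of_circle_subset (hunit : ∀ v ∈ S, ‖v‖ = 1)
    (hrefl : ∀ v ∈ S, ∀ w ∈ S, w - (2 * ⟪v, w⟫) • v ∈ S)
    (b : OrthonormalBasis (Fin 3) ℝ E)
    (hcircle : ∀ θ : ℝ, Real.cos θ • b 0 + Real.sin θ • b 1 ∈ S)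
    {z : E} (hz : z ∈ S) (hz0 : ⟪b 2, z⟫ ≠ 0) (hz1 : ⟪b 2, z⟫ ^ 2 < 1)
    {y : E} (hy : ‖y‖ = 1) : y ∈ S := by
  have hnorm (x : E) : ‖x‖ ^ 2 = ⟪b 0, x⟫ ^ 2 + ⟪b 1, x⟫ ^ 2 + ⟪b 2, x⟫ ^ 2 := by
    rw [← b.sum_sq_inner_right x, Fin.sum_univ_three]
  have hb (i j : Fin 3) : ⟪b i, b j⟫ = if i = j then 1 else 0 :=
    orthonormal_iff_ite.1 b.orthonormal i j
  have hequator {p : E} (hp : ‖p‖ = 1) (hpu : ⟪b 2, p⟫ = 0) : p ∈ S := by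
    have h := hnorm p
    rw [hp, hpu] at h
    obtain ⟨θ, hc, hs⟩ := exists_cos_sin_eq (x := ⟪b 0, p⟫) (y := ⟪b 1, p⟫) (by linarith)
    have hp' := b.sum_repr' p
    rw [Fin.sum_univ_three, hpu, zero_smul, add_zero, ← hc, ← hs] at hp'
    exact hp' ▸ hcircle θ
  have hlat {x y : E} (hx : x ∈ S) (hy : ‖y‖ = 1) (hxy : ⟪b 2, x⟫ = ⟪b 2, y⟫) : y ∈ S := by
    by_cases hne : x = y
    · exact hne ▸ hx
    have hx1 := hunit x hx
    have hd : ‖x - y‖ ≠ 0 := norm_ne_zero_iff.2 (sub_ne_zero.2 hne)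
    have hd2 : ‖x - y‖ ^ 2 = 2 * ⟪x - y, x⟫ := by
      rw [norm_sub_sq_real, inner_sub_left, real_inner_self_eq_norm_sq, real_inner_comm x y, hx1,
        hy]
      ring
    have hp : ‖x - y‖⁻¹ • (x - y) ∈ S := by
      apply hequator
      · rw [norm_smul, norm_inv, norm_norm, inv_mul_cancel₀ hd]
      · rw [real_inner_smul_right, inner_sub_right, hxy, sub_self, mul_zero]
    have h := hrefl _ hp _ hx
    have hc : 2 * (‖x - y‖⁻¹ * ⟪x - y, x⟫) * ‖x - y‖⁻¹ = 1 := by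
      field_simp
      linarith
    rw [real_inner_smul_left, smul_smul, hc, one_smul, sub_sub_cancel] at h
    exact h
  have hstep {h k : ℝ} (hh : h ≠ 0) (hk : k ^ 2 ≤ 4 * h ^ 2 * (1 - h ^ 2))
      (hP : ∀ y : E, ‖y‖ = 1 → ⟪b 2, y⟫ = h → y ∈ S) (y : E) (hy : ‖y‖ = 1)
      (hyk : ⟪b 2, y⟫ = k) : y ∈ S := by
    set a : ℝ := -k / (2 * h) with ha
    have hka : -2 * a * h = k := by rw [ha]; field_simp
    have ha2 : 0 ≤ 1 - h ^ 2 - a ^ 2 := by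
      rw [← hka] at hk
      have h2 : 0 < h ^ 2 := by positivity
      nlinarith
    set r : ℝ := Real.sqrt (1 - h ^ 2 - a ^ 2) with hr
    have hr2 : r ^ 2 = 1 - h ^ 2 - a ^ 2 := Real.sq_sqrt ha2
    set x : E := a • b 0 + r • b 1 + h • b 2 with hx
    have hx0 : ⟪b 0, x⟫ = a := by
      simp [hx, inner_add_right, real_inner_smul_right, hb]
    have hx1 : ⟪b 1, x⟫ = r := by
      simp [hx, inner_add_right, real_inner_smul_right, hb]
    have hx2 : ⟪b 2, x⟫ = h := by
      simp [hx, inner_add_right, real_inner_smul_right, hb]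
    have hxS : x ∈ S := by
      refine hP x ?_ hx2
      have := hnorm x
      rw [hx0, hx1, hx2, hr2] at this
      exact (pow_eq_one_iff_of_nonneg (norm_nonneg _) two_ne_zero).1 (this.trans (by ring))
    have hb0 : b 0 ∈ S := by simpa using hcircle 0
    refine hlat (hrefl x hxS _ hb0) hy ?_
    rw [inner_sub_right, real_inner_smul_right, hx2, real_inner_comm (b 0) x, hx0, hb, hyk, ← hka]
    simp
  let Q : ℝ → Prop := fun c => ∀ k : ℝ, k ^ 2 ≤ c → ∀ y : E, ‖y‖ = 1 → ⟪b 2, y⟫ = k → y ∈ S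
  have hQstep {c d : ℝ} (hc : 0 < c) (hd : d ≤ 4 * c * (1 - c)) (hQ : Q c) : Q d := by
    intro k hk
    have hs : Real.sqrt c ^ 2 = c := Real.sq_sqrt hc.le
    refine hstep (h := Real.sqrt c) (Real.sqrt_pos.2 hc).ne' ?_ (hQ _ hs.le)
    rw [hs]; exact hk.trans hd
  obtain ⟨c, hc, hQc⟩ : ∃ c, 0 < c ∧ Q c := by
    refine ⟨4 * ⟪b 2, z⟫ ^ 2 * (1 - ⟪b 2, z⟫ ^ 2), ?_, fun k hk => ?_⟩
    · have : 0 < ⟪b 2, z⟫ ^ 2 := by positivity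
      have : 0 < 1 - ⟪b 2, z⟫ ^ 2 := by linarith
      positivity
    · exact hstep hz0 hk fun y hy hyz => hlat hz hy hyz.symm
  have hQmono {c d : ℝ} (hcd : d ≤ c) (hQ : Q c) : Q d := fun k hk => hQ k (hk.trans hcd)
  have hQn (n : ℕ) : Q (min (2 ^ n * c) 1) := by
    induction n with
    | zero => exact hQmono (by simp) hQc
    | succ n ih =>
      by_cases hlt : 2 ^ n * c < 1 / 2
      · rw [min_eq_left (by linarith)] at ih
        refine hQstep (by positivity) ?_ ih
        refine (min_le_left _ _).trans ?_
        have : 0 < 2 ^ n * c := by positivity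
        rw [pow_succ]
        nlinarith
      · refine hQmono (min_le_right _ _) (hQstep (c := 1 / 2) (by norm_num) (by norm_num) ?_)
        exact hQmono (le_min (by linarith) (by norm_num)) ih
  obtain ⟨n, hn⟩ := pow_unbounded_of_one_lt (1 / c) (one_lt_two : (1 : ℝ) < 2)
  have hQ1 := hQn n
  rw [div_lt_iff₀ hc] at hn
  rw [min_eq_right hn.le] at hQ1
  refine hQ1 _ ?_ y hy rfl
  have := hnorm y
  rw [hy] at this
  nlinarith [sq_nonneg ⟪b 0, y⟫, sq_nonneg ⟪b 1, y⟫]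

theorem sphere_subset_or_arccos_rational [FiniteDimensional ℝ E] (hE : Module.finrank ℝ E = 3)
    (hS : IsClosed S) (hunit : ∀ v ∈ S, ‖v‖ = 1)
    (hrefl : ∀ v ∈ S, ∀ w ∈ S, w - (2 * ⟪v, w⟫) • v ∈ S)
    {v w z : E} (hv : v ∈ S) (hw : w ∈ S) (hz : z ∈ S) (hvz : ⟪v, z⟫ ≠ 0)
    (hspan : ∀ u : E, ⟪u, v⟫ = 0 → ⟪u, w⟫ = 0 → ⟪u, z⟫ = 0 → u = 0) :
    (∀ y : E, ‖y‖ = 1 → y ∈ S) ∨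
      ∃ m : ℕ, m ≠ 0 ∧ ∃ n : ℤ, m * Real.arccos ⟪v, w⟫ = n * Real.pi := by
  have hv1 := hunit v hv
  have hw1 := hunit w hw
  have hz1 := hunit z hz
  set t := w - ⟪v, w⟫ • v with ht
  have hvt : ⟪v, t⟫ = 0 := by
    rw [ht, inner_sub_right, real_inner_smul_right, real_inner_self_eq_norm_sq, hv1]; ring
  have ht2 : ‖t‖ ^ 2 = 1 - ⟪v, w⟫ ^ 2 := by
    rw [ht, norm_sub_sq_real, norm_smul, real_inner_smul_right, hw1, hv1, real_inner_comm,
      Real.norm_eq_abs, mul_one, sq_abs]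
    ring
  have hle : ⟪v, w⟫ ^ 2 ≤ 1 := by nlinarith [sq_nonneg ‖t‖]
  obtain ⟨hlow, hhigh⟩ := abs_le.1 ((sq_le_one_iff_abs_le_one _).1 hle)
  by_cases ht0 : t = 0
  · right
    rw [ht0, norm_zero] at ht2
    rcases (sq_eq_sq_iff_eq_or_eq_neg).1 (show ⟪v, w⟫ ^ 2 = 1 ^ 2 by linarith) with h | h
    · exact ⟨1, one_ne_zero, 0, by rw [h]; simp⟩
    · exact ⟨1, one_ne_zero, 1, by rw [h]; simp⟩
  have htn : ‖t‖ ≠ 0 := norm_ne_zero_iff.2 ht0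
  have hsin : Real.sin (Real.arccos ⟪v, w⟫) = ‖t‖ := by
    rw [Real.sin_arccos, ← ht2, Real.sqrt_sq (norm_nonneg t)]
  let v' := ‖t‖⁻¹ • t
  have hv' : ‖v'‖ = 1 := by
    rw [norm_smul, norm_inv, norm_norm, inv_mul_cancel₀ htn]
  have hvv' : ⟪v, v'⟫ = 0 := by rw [real_inner_smul_right, hvt, mul_zero]
  have hwv : w = ⟪v, w⟫ • v + ‖t‖ • v' := by
    rw [smul_inv_smul₀ htn, ht]; module
  have hφ : Real.cos (Real.arccos ⟪v, w⟫) • v + Real.sin (Real.arccos ⟪v, w⟫) • v' ∈ S := by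
    rw [Real.cos_arccos hlow hhigh, hsin, ← hwv]; exact hw
  refine (circle_subset_or_arccos_rational hS hrefl hv1 hv' hvv' hv hφ).imp_left
    fun hcircle => ?_
  have hon : Orthonormal ℝ (({0, 1} : Set (Fin 3)).domRestrict ![v, v', 0]) := by
    constructor
    · rintro ⟨i, rfl | rfl⟩ <;> simp [hv1, hv']
    · rintro ⟨i, rfl | rfl⟩ ⟨j, rfl | rfl⟩ hij
      · exact absurd rfl hij
      · exact hvv'
      · exact (real_inner_comm _ _).trans hvv'
      · exact absurd rfl hij
  obtain ⟨b, hb⟩ := hon.exists_orthonormalBasis_extension_of_card_eq (by simpa using hE)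
  have hb0 : b 0 = v := hb 0 (by simp)
  have hb1 : b 1 = v' := hb 1 (by simp)
  have hu1 : ‖b 2‖ = 1 := b.norm_eq_one 2
  have huv : ⟪b 2, v⟫ = 0 := by rw [← hb0]; exact b.inner_eq_zero (by decide)
  have huv' : ⟪b 2, v'⟫ = 0 := by rw [← hb1]; exact b.inner_eq_zero (by decide)
  have huw : ⟪b 2, w⟫ = 0 := by
    rw [hwv, inner_add_right, real_inner_smul_right, real_inner_smul_right, huv, huv']; ring
  intro y hy
  refine sphere_subset_of_circle_subset hunit hrefl b (by rwa [hb0, hb1]) hz ?_ ?_ hy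
  · intro h
    have := hspan _ huv huw h
    rw [this, norm_zero] at hu1
    exact zero_ne_one hu1
  · have h := b.sum_sq_inner_right z
    rw [Fin.sum_univ_three, hb0, hz1] at h
    have : 0 < ⟪v, z⟫ ^ 2 := by positivity
    nlinarith [sq_nonneg ⟪b 1, z⟫]

end ReflectionClosed

section OrthogonalGroup

variable {ι : Type*} [DecidableEq ι]

/-- The matrix of the reflection in the hyperplane orthogonal to a unit vector `v`. -/
def hyperplaneReflection (v : EuclideanSpace ℝ ι) : Matrix ι ι ℝ :=
  1 - (2 : ℝ) • Matrix.vecMulVec v v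

theorem transpose_hyperplaneReflection (v : EuclideanSpace ℝ ι) :
    (hyperplaneReflection v).transpose = hyperplaneReflection v := by
  simp [hyperplaneReflection, Matrix.transpose_vecMulVec]

theorem continuous_hyperplaneReflection :
    Continuous (hyperplaneReflection : EuclideanSpace ℝ ι → Matrix ι ι ℝ) := by
  refine continuous_matrix fun i j => ?_
  simp only [hyperplaneReflection, Matrix.sub_apply, Matrix.smul_apply, Matrix.vecMulVec_apply]
  fun_prop

variable [Fintype ι]

theorem hyperplaneReflection_mulVec (v x : EuclideanSpace ℝ ι) :
    (hyperplaneReflection v).mulVec x = (x - (2 * ⟪v, x⟫) • v).ofLp := by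
  rw [hyperplaneReflection, Matrix.sub_mulVec, Matrix.one_mulVec, Matrix.smul_mulVec,
    Matrix.vecMulVec_mulVec, EuclideanSpace.inner_eq_star_dotProduct]
  ext i
  simp only [dotProduct_comm v.ofLp, star_trivial, Pi.sub_apply, Pi.smul_apply, op_smul_eq_smul,
    smul_eq_mul, PiLp.sub_apply, PiLp.smul_apply]
  ring

/-- The unit normals of the hyperplane reflections contained in a subgroup of the orthogonal
group. -/
def reflectionNormals (H : Subgroup (Matrix.orthogonalGroup ι ℝ)) : Set (EuclideanSpace ℝ ι) :=
  {v | ‖v‖ = 1 ∧ ∃ A ∈ H, (A : Matrix ι ι ℝ) = hyperplaneReflection v}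

theorem isClosed_reflectionNormals {H : Subgroup (Matrix.orthogonalGroup ι ℝ)}
    (hH : IsClosed (H : Set (Matrix.orthogonalGroup ι ℝ))) : IsClosed (reflectionNormals H) := by
  have himg : IsClosed ((fun A : Matrix.orthogonalGroup ι ℝ => (A : Matrix ι ι ℝ)) '' H) :=
    (isClosed_unitary (R := Matrix ι ι ℝ)).isClosedMap_subtype_val _ hH
  exact (isClosed_eq continuous_norm continuous_const).inter
    (himg.preimage continuous_hyperplaneReflection)

theorem sub_smul_mem_reflectionNormals {H : Subgroup (Matrix.orthogonalGroup ι ℝ)}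
    {v w : EuclideanSpace ℝ ι} (hv : v ∈ reflectionNormals H) (hw : w ∈ reflectionNormals H) :
    w - (2 * ⟪v, w⟫) • v ∈ reflectionNormals H := by
  obtain ⟨hv1, A, hA, hAv⟩ := hv
  obtain ⟨hw1, B, hB, hBw⟩ := hw
  have hAA : (A : Matrix ι ι ℝ) * A = 1 := by
    have h := A.2.1
    rwa [Matrix.star_eq_conjTranspose, Matrix.conjTranspose_eq_transpose_of_trivial, hAv,
      transpose_hyperplaneReflection, ← hAv] at h
  refine ⟨?_, A * B * A, mul_mem (mul_mem hA hB) hA, ?_⟩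
  · rw [← pow_eq_one_iff_of_nonneg (norm_nonneg _) two_ne_zero, norm_sub_sq_real, norm_smul,
      real_inner_smul_right, hw1, hv1, real_inner_comm, Real.norm_eq_abs, mul_one, sq_abs]
    ring
  · have h1 : (A : Matrix ι ι ℝ).mulVec w = (w - (2 * ⟪v, w⟫) • v).ofLp := by
      rw [hAv, hyperplaneReflection_mulVec]
    have h2 : Matrix.vecMul w (A : Matrix ι ι ℝ) = (w - (2 * ⟪v, w⟫) • v).ofLp := by
      rw [← h1, ← Matrix.vecMul_transpose, hAv, transpose_hyperplaneReflection]
    rw [hyperplaneReflection, ← h1]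
    nth_rewrite 2 [h1]
    rw [← h2]
    change (A : Matrix ι ι ℝ) * B * A = _
    rw [hBw, hyperplaneReflection, Matrix.mul_sub, Matrix.sub_mul, Matrix.mul_one, hAA,
      Matrix.mul_smul, Matrix.smul_mul, Matrix.mul_vecMulVec, Matrix.vecMulVec_mul]

theorem eq_top_of_forall_mem_reflectionNormals {H : Subgroup (Matrix.orthogonalGroup ι ℝ)}
    (h : ∀ v : EuclideanSpace ℝ ι, ‖v‖ = 1 → v ∈ reflectionNormals H) : H = ⊤ := by
  have key (f : EuclideanSpace ℝ ι ≃ₗᵢ[ℝ] EuclideanSpace ℝ ι) :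
      ∃ B ∈ H, ∀ x : EuclideanSpace ℝ ι, (B : Matrix ι ι ℝ).mulVec x = (f x).ofLp := by
    have hf : f ∈ Subgroup.closure (Set.range fun v : EuclideanSpace ℝ ι =>
        (Submodule.span ℝ {v})ᗮ.reflection) := by
      rw [LinearIsometryEquiv.reflections_generate]; trivial
    induction hf using Subgroup.closure_induction with
    | mem f hf =>
      obtain ⟨v, rfl⟩ := hf
      by_cases hv : v = 0
      · subst hv
        refine ⟨1, one_mem H, fun x => ?_⟩
        rw [Submodule.reflection_orthogonal_apply, Submodule.reflection_singleton_apply]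
        simp
      · have hv0 : ‖v‖ ≠ 0 := norm_ne_zero_iff.2 hv
        obtain ⟨-, A, hA, hAv⟩ := h (‖v‖⁻¹ • v)
          (by rw [norm_smul, norm_inv, norm_norm, inv_mul_cancel₀ hv0])
        refine ⟨A, hA, fun x => ?_⟩
        rw [hAv, hyperplaneReflection_mulVec, Submodule.reflection_orthogonal_apply,
          Submodule.reflection_singleton_apply]
        congr 1
        rw [real_inner_smul_left, neg_sub, smul_smul, ← Nat.cast_smul_eq_nsmul ℝ, smul_smul]
        congr 2
        simp only [RCLike.ofReal_real_eq_id, id_eq]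
        field_simp
        push_cast
        ring
    | one => exact ⟨1, one_mem H, fun x => by simp⟩
    | mul f g _ _ hf hg =>
      obtain ⟨A, hA, hAf⟩ := hf
      obtain ⟨B, hB, hBg⟩ := hg
      refine ⟨A * B, mul_mem hA hB, fun x => ?_⟩
      change ((A : Matrix ι ι ℝ) * B).mulVec x = _
      rw [← Matrix.mulVec_mulVec, hBg, hAf]
      rfl
    | inv f _ hf =>
      obtain ⟨A, hA, hAf⟩ := hf
      refine ⟨A⁻¹, inv_mem hA, fun x => ?_⟩
      have h1 : (f (f⁻¹ x)) = x := f.apply_symm_apply x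
      have h2 : ((A⁻¹ : Matrix.orthogonalGroup ι ℝ) : Matrix ι ι ℝ) * (A : Matrix ι ι ℝ) = 1 :=
        congrArg Subtype.val (inv_mul_cancel A)
      nth_rewrite 1 [← h1]
      rw [← hAf, Matrix.mulVec_mulVec, h2, Matrix.one_mulVec]
  rw [Subgroup.eq_top_iff']
  intro A
  let f := Unitary.linearIsometryEquiv
    (⟨Matrix.toEuclideanCLM (𝕜 := ℝ) (A : Matrix ι ι ℝ), Unitary.map_mem _ A.2⟩ :
      unitary (EuclideanSpace ℝ ι →L[ℝ] EuclideanSpace ℝ ι))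
  obtain ⟨B, hB, hBf⟩ := key f
  have hAB : A = B := by
    apply Subtype.ext
    apply Matrix.ext_of_mulVec_single
    intro i
    exact (hBf (WithLp.toLp 2 (Pi.single i 1))).symm
  exact hAB ▸ hB

end OrthogonalGroup

/-- Any nontrivial real beamsplitter `b = [[α, β], [β, -α]]`
(with `α² + β² = 1`, `α ≠ 0`, `β ≠ 0`) densely generates the orthogonal group `O(3)`:
the subgroup of `O(3)` generated by `b₁₂`, `b₁₃`, `b₂₃` is dense in `O(3)`. -/
theorem real_beamsplitter_dense_in_O3
    (α β : ℝ) (hnorm : α ^ 2 + β ^ 2 = 1) (hα : α ≠ 0) (hβ : β ≠ 0)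
    (B12 B13 B23 : Matrix.orthogonalGroup (Fin 3) ℝ)
    (hB12 : (B12 : Matrix (Fin 3) (Fin 3) ℝ) = !![α, β, 0; β, -α, 0; 0, 0, 1])
    (hB13 : (B13 : Matrix (Fin 3) (Fin 3) ℝ) = !![α, 0, β; 0, 1, 0; β, 0, -α])
    (hB23 : (B23 : Matrix (Fin 3) (Fin 3) ℝ) = !![1, 0, 0; 0, α, β; 0, β, -α]) :
    Dense ((Subgroup.closure {B12, B13, B23} : Subgroup (Matrix.orthogonalGroup (Fin 3) ℝ)) :
      Set (Matrix.orthogonalGroup (Fin 3) ℝ)) := by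
  set H := (Subgroup.closure {B12, B13, B23}).topologicalClosure with hH
  have hsub : ({B12, B13, B23} : Set (Matrix.orthogonalGroup (Fin 3) ℝ)) ⊆ H :=
    Subgroup.subset_closure.trans (Subgroup.le_topologicalClosure _)
  have hα2 : α ^ 2 < 1 := by
    have : 0 < β ^ 2 := by positivity
    linarith
  obtain ⟨hα_low, hα_high⟩ := abs_lt.1 ((sq_lt_one_iff_abs_lt_one _).1 hα2)
  obtain ⟨s, c, hs, hc, hs2, hc2, hsc⟩ : ∃ s c : ℝ, s ≠ 0 ∧ c ≠ 0 ∧ s ^ 2 = (1 - α) / 2 ∧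
      c ^ 2 = (1 + α) / 2 ∧ 2 * (s * c) = β := by
    have hs2 : Real.sqrt ((1 - α) / 2) ^ 2 = (1 - α) / 2 := Real.sq_sqrt (by linarith)
    have hs : Real.sqrt ((1 - α) / 2) ≠ 0 := (Real.sqrt_pos.2 (by linarith)).ne'
    refine ⟨_, β / (2 * Real.sqrt ((1 - α) / 2)), hs, by positivity, hs2, ?_, by field_simp⟩
    have : 1 - α ≠ 0 := by linarith
    rw [div_pow, mul_pow, hs2]
    field_simp
    linarith
  have hsc1 : s ^ 2 + c ^ 2 = 1 := by rw [hs2, hc2]; ring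
  have hne : s ≠ c := by
    rintro rfl
    exact hα (by linarith)
  let v12 : EuclideanSpace ℝ (Fin 3) := !₂[s, -c, 0]
  let v13 : EuclideanSpace ℝ (Fin 3) := !₂[s, 0, -c]
  let v23 : EuclideanSpace ℝ (Fin 3) := !₂[0, s, -c]
  have h12 : v12 ∈ reflectionNormals H := by
    refine ⟨by simp [v12, EuclideanSpace.norm_eq, Fin.sum_univ_three, hsc1],
      B12, hsub (by simp), ?_⟩
    rw [hB12]
    ext i j
    fin_cases i <;> fin_cases j <;>
      simp [hyperplaneReflection, v12] <;> linarith
  have h13 : v13 ∈ reflectionNormals H := by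
    refine ⟨by simp [v13, EuclideanSpace.norm_eq, Fin.sum_univ_three, hsc1],
      B13, hsub (by simp), ?_⟩
    rw [hB13]
    ext i j
    fin_cases i <;> fin_cases j <;>
      simp [hyperplaneReflection, v13] <;> linarith
  have h23 : v23 ∈ reflectionNormals H := by
    refine ⟨by simp [v23, EuclideanSpace.norm_eq, Fin.sum_univ_three, hsc1],
      B23, hsub (by simp), ?_⟩
    rw [hB23]
    ext i j
    fin_cases i <;> fin_cases j <;>
      simp [hyperplaneReflection, v23] <;> linarith
  have h12_13 : ⟪v12, v13⟫ = s ^ 2 := by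
    simp [v12, v13, PiLp.inner_apply, Fin.sum_univ_three, sq]
  have h13_23 : ⟪v13, v23⟫ = c ^ 2 := by
    simp [v13, v23, PiLp.inner_apply, Fin.sum_univ_three, sq]
  have h12_23 : ⟪v12, v23⟫ = -(s * c) := by
    simp [v12, v23, PiLp.inner_apply, Fin.sum_univ_three]
  have hspan (u : EuclideanSpace ℝ (Fin 3)) (hu12 : ⟪u, v12⟫ = 0) (hu13 : ⟪u, v13⟫ = 0)
      (hu23 : ⟪u, v23⟫ = 0) : u = 0 := by
    simp [v12, v13, v23, PiLp.inner_apply, Fin.sum_univ_three] at hu12 hu13 hu23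
    have h12 : u 1 = u 2 := mul_left_cancel₀ hc (by linarith)
    have h2 : u 2 = 0 := by
      rw [h12] at hu23
      refine (mul_eq_zero.1 (show (s - c) * u 2 = 0 by linarith)).resolve_left ?_
      exact sub_ne_zero.2 hne
    have h1 : u 1 = 0 := h12.trans h2
    have h0 : u 0 = 0 := by simpa [h1, hs] using hu12
    ext i
    fin_cases i <;> simp [h0, h1, h2]
  have hclosed : IsClosed (reflectionNormals H) :=
    isClosed_reflectionNormals (Subgroup.isClosed_topologicalClosure _)
  have hrefl : ∀ v ∈ reflectionNormals H, ∀ w ∈ reflectionNormals H,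
      w - (2 * ⟪v, w⟫) • v ∈ reflectionNormals H :=
    fun v hv w hw => sub_smul_mem_reflectionNormals hv hw
  have hall : ∀ y : EuclideanSpace ℝ (Fin 3), ‖y‖ = 1 → y ∈ reflectionNormals H := by
    rcases sphere_subset_or_arccos_rational (by simp) hclosed (fun v hv => hv.1) hrefl h12 h13 h23
      (by rw [h12_23]; exact neg_ne_zero.2 (mul_ne_zero hs hc)) hspan with h | hrat
    · exact h
    rcases sphere_subset_or_arccos_rational (by simp) hclosed (fun v hv => hv.1) hrefl h13 h23 h12
      (by rw [real_inner_comm, h12_13]; exact pow_ne_zero 2 hs)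
      (fun u hu13 hu23 hu12 => hspan u hu12 hu13 hu23) with h | hrat'
    · exact h
    rw [h12_13] at hrat
    rw [h13_23] at hrat'
    obtain ⟨z, k, hk, hz, hza⟩ := exists_rootOfUnity_of_arccos_rational
      (by nlinarith [sq_nonneg s]) (by nlinarith [sq_nonneg c]) hrat
    obtain ⟨w, l, hl, hw, hwb⟩ := exists_rootOfUnity_of_arccos_rational
      (by nlinarith [sq_nonneg c]) (by nlinarith [sq_nonneg s]) hrat'
    have := eq_of_rootOfUnity_cosines_add_eq_one hsc1 (by positivity) hk hl hz hw hza hwb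
    exact absurd (by linarith) hα
  have htop := eq_top_of_forall_mem_reflectionNormals hall
  rw [dense_iff_closure_eq, ← Subgroup.topologicalClosure_coe, ← hH, htop, Subgroup.coe_top]
end

section
/- Let b be a nontrivial real beamsplitter, i.e. b = [[α, β],[β, −α]] with α, β ∈ ℝ, α² + β² = 1, α ≠ 0, β ≠ 0, and let m ≥ 3. Then the subgroup of the orthogonal group O(m) generated by all the matrices b_{ij} for 1 ≤ i < j ≤ m is dense in O(m). -/
/-- The m×m matrix obtained by applying the real beamsplitter `[[α, β], [β, -α]]` to
coordinates `i` and `j` (with `i < j`) and the identity on all other coordinates. -/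
def realBeamsplitterOn {m : ℕ} (α β : ℝ) (i j : Fin m) : Matrix (Fin m) (Fin m) ℝ :=
  Matrix.of fun k l =>
    if k = i ∧ l = i then α
    else if k = i ∧ l = j then β
    else if k = j ∧ l = i then β
    else if k = j ∧ l = j then -α
    else if k = l then 1 else 0

/-- If `a / π` is rational then `exp (a * I)` is a root of unity. -/
theorem exists_exp_mul_I_pow_eq_one {a : ℝ} (ha : ¬ Irrational (a / Real.pi)) :
    ∃ n : ℕ, 0 < n ∧ Complex.exp (a * Complex.I) ^ n = 1 := by
  obtain ⟨q, hq⟩ := not_not.mp ha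
  refine ⟨2 * q.den, by have := q.den_pos; omega, ?_⟩
  have h : a = q * Real.pi := by
    rw [hq]; field_simp
  have hd : (q.den : ℂ) * (q : ℂ) = (q.num : ℂ) := by
    have := Rat.den_mul_eq_num q
    exact_mod_cast congrArg (fun r : ℚ => (r : ℂ)) this
  rw [← Complex.exp_nat_mul, Complex.exp_eq_one_iff]
  refine ⟨q.num, ?_⟩
  rw [h]
  push_cast
  linear_combination (2 * Real.pi * Complex.I) * hd

theorem add_inv_eq_two_mul_re {z : ℂ} {n : ℕ} (hn : 0 < n) (hz : z ^ n = 1) :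
    z + z⁻¹ = ((2 * z.re : ℝ) : ℂ) ∧ |z.re| ≤ 1 := by
  have h1 : ‖z‖ = 1 := Complex.norm_eq_one_of_pow_eq_one hz hn.ne'
  refine ⟨?_, h1 ▸ Complex.abs_re_le_norm z⟩
  rw [Complex.inv_eq_conj h1, Complex.add_conj]

theorem exp_add_inv (a : ℝ) :
    Complex.exp (a * Complex.I) + (Complex.exp (a * Complex.I))⁻¹
      = ((2 * Real.cos a : ℝ) : ℂ) := by
  rw [← Complex.exp_neg]
  push_cast
  rw [Complex.two_cos]
  ring_nf

/-- Two cosines that sum to one cannot both belong to rational multiples of `π`, unless they are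
`0` and `1` or both `1 / 2`. Otherwise `x` would be an algebraic integer all of whose conjugates have
absolute value at most one (Kronecker). -/
theorem irrational_angle_of_two_cos {x a b : ℝ} (hx : x ≠ 0) (hx1 : |x| < 1)
    (ha : 2 * Real.cos a = 1 - x) (hb : 2 * Real.cos b = 1 + x) :
    Irrational (a / Real.pi) ∨ Irrational (b / Real.pi) := by
  by_contra! hcon
  obtain ⟨n, hn, hζn⟩ := exists_exp_mul_I_pow_eq_one hcon.1
  obtain ⟨k, hk, hωk⟩ := exists_exp_mul_I_pow_eq_one hcon.2
  have hζx := exp_add_inv a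
  have hωx := exp_add_inv b
  rw [ha] at hζx
  rw [hb] at hωx
  generalize Complex.exp (a * Complex.I) = ζ at *
  generalize Complex.exp (b * Complex.I) = ω at *
  have integral_of_pow {R L : Type} [CommRing R] [Field L] [Algebra R L] {z : L} {l : ℕ}
      (hl : 0 < l) (hz : z ^ l = 1) : IsIntegral R z :=
    IsIntegral.of_pow hl (hz ▸ isIntegral_one)
  let K := IntermediateField.adjoin ℚ ({ζ, ω} : Set ℂ)
  have : FiniteDimensional ℚ K :=
    IntermediateField.finiteDimensional_adjoin_pair (integral_of_pow hn hζn)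
      (integral_of_pow hk hωk)
  have : NumberField K := ⟨⟩
  have hζK : ζ ∈ K := IntermediateField.subset_adjoin _ _ (by simp)
  have hωK : ω ∈ K := IntermediateField.subset_adjoin _ _ (by simp)
  let z : K := ⟨ζ, hζK⟩
  let w : K := ⟨ω, hωK⟩
  have hz : z ^ n = 1 := Subtype.ext (by simpa [z] using hζn)
  have hw : w ^ k = 1 := Subtype.ext (by simpa [w] using hωk)
  let y : K := 1 - (z + z⁻¹)
  have hyx : (y : ℂ) = x := by
    have : (y : ℂ) = 1 - (ζ + ζ⁻¹) := by simp [y, z]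
    rw [this, hζx]; push_cast; ring
  have hyw : y = (w + w⁻¹) - 1 := by
    apply Subtype.ext
    have : (((w + w⁻¹) - 1 : K) : ℂ) = (ω + ω⁻¹) - 1 := by simp [w]
    rw [this, hyx, hωx]; push_cast; ring
  have hint : IsIntegral ℤ y :=
    isIntegral_one.sub ((integral_of_pow hn hz).add
      (integral_of_pow hn (by rw [inv_pow, hz, inv_one])))
  have hbound (φ : K →+* ℂ) : ‖φ y‖ ≤ 1 := by
    obtain ⟨h1, h2⟩ := add_inv_eq_two_mul_re hn (by rw [← map_pow, hz, map_one] : φ z ^ n = 1)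
    obtain ⟨h3, h4⟩ := add_inv_eq_two_mul_re hk (by rw [← map_pow, hw, map_one] : φ w ^ k = 1)
    have e1 : φ y = ((1 - 2 * (φ z).re : ℝ) : ℂ) := by
      simp only [y, map_sub, map_one, map_add, map_inv₀]
      rw [h1]; push_cast; ring
    have e2 : φ y = ((2 * (φ w).re - 1 : ℝ) : ℂ) := by
      rw [hyw]
      simp only [map_sub, map_one, map_add, map_inv₀]
      rw [h3]; push_cast; ring
    have e3 : 1 - 2 * (φ z).re = 2 * (φ w).re - 1 := by
      exact_mod_cast e1.symm.trans e2
    rw [e1, Complex.norm_real, Real.norm_eq_abs]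
    rw [abs_le] at *
    constructor <;> linarith
  have hfin := NumberField.Embeddings.finite_of_norm_le K ℂ 1
  have hinj : Function.Injective fun l : ℕ => y ^ l := by
    intro l l' h
    have h' : (|x|) ^ l = |x| ^ l' := by
      have : ((y ^ l : K) : ℂ) = ((y ^ l' : K) : ℂ) := congrArg _ h
      simp only [SubmonoidClass.coe_pow] at this
      rw [hyx] at this
      rw [← abs_pow, ← abs_pow]
      congr 1
      exact_mod_cast this
    exact (pow_right_strictAnti₀ (abs_pos.mpr hx) hx1).injective h'
  refine Set.infinite_range_of_injective hinj (hfin.subset ?_)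
  rintro _ ⟨l, rfl⟩
  refine ⟨hint.pow l, fun φ => ?_⟩
  simp only [map_pow, norm_pow]
  exact pow_le_one₀ (norm_nonneg _) (hbound φ)

/-- A closed set of vectors that is stable under scaling and under the reflections along its own
members. -/
structure IsReflectionClosed {E : Type*} [NormedAddCommGroup E] [InnerProductSpace ℝ E]
    (S : Set E) : Prop where
  isClosed : IsClosed S
  smul_mem : ∀ (c : ℝ) {v : E}, v ∈ S → c • v ∈ S
  reflect_mem : ∀ {v w : E}, v ∈ S → w ∈ S →
    (inner ℝ v v : ℝ) • w - (2 * inner ℝ v w : ℝ) • v ∈ S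

namespace IsReflectionClosed

variable {E : Type*} [NormedAddCommGroup E] [InnerProductSpace ℝ E] {S : Set E}

theorem mem_of_smul_mem (hS : IsReflectionClosed S) {c : ℝ} (hc : c ≠ 0) {v : E}
    (h : c • v ∈ S) : v ∈ S := by
  simpa [smul_smul, hc] using hS.smul_mem c⁻¹ h

theorem mem_of_reflect_mem (hS : IsReflectionClosed S) {v w : E} (hv : v ∈ S) (hv0 : v ≠ 0)
    (h : (inner ℝ v v : ℝ) • w - (2 * inner ℝ v w : ℝ) • v ∈ S) : w ∈ S := by
  have h0 : (inner ℝ v v : ℝ) ≠ 0 := inner_self_ne_zero.mpr hv0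
  refine hS.mem_of_smul_mem (mul_ne_zero h0 h0) ?_
  convert hS.reflect_mem hv h using 1
  simp only [inner_sub_right, inner_smul_right]
  module

/-- If two members of `S` enclose an angle that is an irrational multiple of `π`, then `S` contains
the whole circle through them. -/
theorem circle_mem (hS : IsReflectionClosed S) {e f : E} (he : inner ℝ e e = (1 : ℝ))
    (hf : inner ℝ f f = (1 : ℝ)) (hef : inner ℝ e f = (0 : ℝ)) (heS : e ∈ S) {a : ℝ}
    (ha : Irrational (a / Real.pi)) (haS : Real.cos a • e + Real.sin a • f ∈ S) (θ : ℝ) :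
    Real.cos θ • e + Real.sin θ • f ∈ S := by
  have hfe : inner ℝ f e = (0 : ℝ) := by rw [real_inner_comm]; exact hef
  let u : ℝ → E := fun θ => Real.cos θ • e + Real.sin θ • f
  have hinner (s t : ℝ) : inner ℝ (u s) (u t) = Real.cos (s - t) := by
    simp only [u, inner_add_left, inner_add_right, inner_smul_left, inner_smul_right, he, hf, hef,
      hfe, Real.cos_sub]
    simp [mul_comm]
  have hrefl (s t : ℝ) : (inner ℝ (u s) (u s) : ℝ) • u t - (2 * inner ℝ (u s) (u t) : ℝ) • u s
      = (-1 : ℝ) • u (2 * s - t) := by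
    have e1 : Real.cos t - 2 * Real.cos (s - t) * Real.cos s = - Real.cos (2 * s - t) := by
      rw [show 2 * s - t = (s - t) + s by ring, Real.cos_add]
      conv_lhs => rw [show t = s - (s - t) by ring, Real.cos_sub]
      ring_nf
    have e2 : Real.sin t - 2 * Real.cos (s - t) * Real.sin s = - Real.sin (2 * s - t) := by
      rw [show 2 * s - t = (s - t) + s by ring, Real.sin_add]
      conv_lhs => rw [show t = s - (s - t) by ring, Real.sin_sub]
      ring_nf
    rw [hinner, hinner, sub_self, Real.cos_zero]
    have : (1 : ℝ) • u t - (2 * Real.cos (s - t)) • u s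
        = (Real.cos t - 2 * Real.cos (s - t) * Real.cos s) • e
          + (Real.sin t - 2 * Real.cos (s - t) * Real.sin s) • f := by
      simp only [u]; module
    rw [this, e1, e2]
    simp only [u]; module
  have hstep {s t : ℝ} (hs : u s ∈ S) (ht : u t ∈ S) : u (2 * s - t) ∈ S := by
    have := hS.reflect_mem hs ht
    rw [hrefl] at this
    exact hS.mem_of_smul_mem (by norm_num) this
  have hzero : u 0 ∈ S := by simpa [u] using heS
  have haS' : u a ∈ S := haS
  have hneg {t : ℝ} (ht : u t ∈ S) : u (-t) ∈ S := by simpa using hstep hzero ht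
  have hadd {t : ℝ} (ht : u t ∈ S) : u (t + 2 * a) ∈ S := by
    have := hstep haS' (hneg ht)
    rwa [show 2 * a - -t = t + 2 * a by ring] at this
  have hpi {t : ℝ} (ht : u t ∈ S) : u (t + Real.pi) ∈ S := by
    have := hS.smul_mem (-1) ht
    convert this using 1
    simp only [u, Real.cos_add_pi, Real.sin_add_pi]
    module
  have hdense : Dense (AddSubgroup.closure {2 * a, Real.pi} : Set ℝ) := by
    rw [dense_addSubgroupClosure_pair_iff, mul_div_assoc]
    exact_mod_cast ha.natCast_mul (m := 2) (by norm_num)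
  have hclosed : IsClosed (u ⁻¹' S) := hS.isClosed.preimage (by fun_prop)
  have hsub : (AddSubgroup.closure {2 * a, Real.pi} : Set ℝ) ⊆ u ⁻¹' S := by
    intro g hg
    induction hg using AddSubgroup.closure_induction_right with
    | zero => exact hzero
    | add_right g _ t ht h =>
      rcases ht with rfl | rfl
      · exact hadd h
      · exact hpi h
    | add_neg_cancel g _ t ht h =>
      have h' := hneg h
      rcases ht with rfl | rfl
      · simpa [add_comm, sub_eq_add_neg] using hneg (hadd h')
      · simpa [add_comm, sub_eq_add_neg] using hneg (hpi h')
  have := hclosed.closure_subset_iff.mpr hsub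
  rw [hdense.closure_eq] at this
  exact this (Set.mem_univ θ)

/-- Two members of `S` whose angle is an irrational multiple of `π` span a plane in `S`. -/
theorem exists_plane (hS : IsReflectionClosed S) {x y : E} (hx : x ∈ S) (hy : y ∈ S)
    (hx0 : x ≠ 0) (hy0 : y ≠ 0)
    (h : Irrational (InnerProductGeometry.angle x y / Real.pi)) :
    ∃ V : Submodule ℝ E, (V : Set E) ⊆ S ∧ x ∈ V ∧ y ∈ V ∧
      ∃ e ∈ V, ∃ f ∈ V, inner ℝ e e = (1 : ℝ) ∧ inner ℝ f f = (1 : ℝ) ∧ inner ℝ e f = (0 : ℝ) := by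
  set a := InnerProductGeometry.angle x y with ha
  have hnx : ‖x‖ ≠ 0 := norm_ne_zero_iff.mpr hx0
  have hny : ‖y‖ ≠ 0 := norm_ne_zero_iff.mpr hy0
  have hsin : Real.sin a ≠ 0 := by
    intro h0
    rw [Real.sin_eq_zero_iff] at h0
    obtain ⟨n, hn⟩ := h0
    apply h
    refine ⟨n, ?_⟩
    rw [← hn]
    field_simp
    simp
  have hcos : inner ℝ x y = Real.cos a * (‖x‖ * ‖y‖) :=
    (InnerProductGeometry.cos_angle_mul_norm_mul_norm x y).symm
  let e : E := ‖x‖⁻¹ • x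
  let g : E := ‖y‖⁻¹ • y
  let f : E := (Real.sin a)⁻¹ • (g - Real.cos a • e)
  have hee : inner ℝ e e = (1 : ℝ) := by
    simp only [e, real_inner_smul_left, real_inner_smul_right]
    rw [real_inner_self_eq_norm_sq]
    field_simp
  have hgg : inner ℝ g g = (1 : ℝ) := by
    simp only [g, real_inner_smul_left, real_inner_smul_right]
    rw [real_inner_self_eq_norm_sq]
    field_simp
  have heg : inner ℝ e g = Real.cos a := by
    simp only [e, g, real_inner_smul_left, real_inner_smul_right, hcos]
    field_simp
  have hge : inner ℝ g e = Real.cos a := by rw [real_inner_comm, heg]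
  have hef : inner ℝ e f = (0 : ℝ) := by
    simp only [f, real_inner_smul_right, inner_sub_right, hee, heg]
    simp
  have hff : inner ℝ f f = (1 : ℝ) := by
    simp only [f, real_inner_smul_right, real_inner_smul_left, inner_sub_right, inner_sub_left,
      hee, heg, hge, hgg]
    have := Real.sin_sq_add_cos_sq a
    field_simp
    linarith
  have heS : e ∈ S := hS.smul_mem _ hx
  have hgS : Real.cos a • e + Real.sin a • f = g := by
    simp only [f, smul_smul, mul_inv_cancel₀ hsin]
    module
  have hcirc := hS.circle_mem hee hff hef heS h (hgS ▸ hS.smul_mem _ hy)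
  have hgx : y = ‖y‖ • g := by simp [g, smul_smul, hny]
  have hxe : x = ‖x‖ • e := by simp [e, smul_smul, hnx]
  have heV : e ∈ Submodule.span ℝ {e, f} := Submodule.subset_span (by simp)
  have hfV : f ∈ Submodule.span ℝ {e, f} := Submodule.subset_span (by simp)
  refine ⟨Submodule.span ℝ {e, f}, ?_, ?_, ?_, e, heV, f, hfV, hee, hff, hef⟩
  · intro v hv
    obtain ⟨c, d, rfl⟩ := Submodule.mem_span_pair.mp hv
    have := hS.smul_mem ‖(⟨c, d⟩ : ℂ)‖ (hcirc (Complex.arg ⟨c, d⟩))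
    rw [smul_add, smul_smul _ _ e, smul_smul _ _ f, Complex.norm_mul_cos_arg, Complex.norm_mul_sin_arg] at this
    exact this
  · rw [hxe]; exact Submodule.smul_mem _ _ heV
  · rw [hgx, ← hgS]
    exact Submodule.smul_mem _ _ (add_mem (Submodule.smul_mem _ _ heV)
      (Submodule.smul_mem _ _ hfV))

theorem exists_orthogonal_unit {V : Submodule ℝ E} {e f : E} (heV : e ∈ V) (hfV : f ∈ V)
    (he : inner ℝ e e = (1 : ℝ)) (hf : inner ℝ f f = (1 : ℝ)) (hef : inner ℝ e f = (0 : ℝ))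
    (x : E) : ∃ g ∈ V, inner ℝ g g = (1 : ℝ) ∧ inner ℝ x g = (0 : ℝ) := by
  by_cases hx : inner ℝ x e = (0 : ℝ)
  · exact ⟨e, heV, he, hx⟩
  · have hfe : inner ℝ f e = (0 : ℝ) := by rw [real_inner_comm]; exact hef
    let g : E := (inner ℝ x f : ℝ) • e - (inner ℝ x e : ℝ) • f
    have hg : inner ℝ g g = (inner ℝ x f : ℝ) ^ 2 + (inner ℝ x e : ℝ) ^ 2 := by
      simp only [g, inner_sub_left, inner_sub_right, real_inner_smul_left, real_inner_smul_right,
        he, hf, hef, hfe]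
      ring
    have hg0 : ‖g‖ ≠ 0 := by
      rw [norm_ne_zero_iff, ← inner_self_ne_zero (𝕜 := ℝ), hg]
      positivity
    refine ⟨‖g‖⁻¹ • g, V.smul_mem _ (V.sub_mem (V.smul_mem _ heV) (V.smul_mem _ hfV)), ?_, ?_⟩
    · simp only [real_inner_smul_left, real_inner_smul_right]
      rw [real_inner_self_eq_norm_sq]
      field_simp
    · rw [real_inner_smul_right]
      simp only [g, inner_sub_right, real_inner_smul_right]
      ring

/-- In a space of dimension at least two there are vectors of any given norm that have any
inner product with a given vector allowed by the Cauchy–Schwarz inequality. -/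
theorem exists_norm_eq_inner_eq {V : Submodule ℝ E} {e f : E} (heV : e ∈ V) (hfV : f ∈ V)
    (he : inner ℝ e e = (1 : ℝ)) (hf : inner ℝ f f = (1 : ℝ)) (hef : inner ℝ e f = (0 : ℝ))
    {x : E} (hx : x ∈ V) {r c : ℝ} (hr : 0 ≤ r) (hc : |c| ≤ r * ‖x‖) :
    ∃ p ∈ V, ‖p‖ = r ∧ inner ℝ p x = c := by
  obtain ⟨g, hgV, hgg, hxg⟩ := exists_orthogonal_unit heV hfV he hf hef x
  have hgx : inner ℝ g x = (0 : ℝ) := by rw [real_inner_comm]; exact hxg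
  by_cases hx0 : x = 0
  · subst hx0
    have hc0 : c = 0 := by simpa using hc
    have hg1 : ‖g‖ = 1 := by
      rw [real_inner_self_eq_norm_sq] at hgg
      nlinarith [norm_nonneg g]
    exact ⟨r • g, V.smul_mem _ hgV, by rw [norm_smul, hg1, Real.norm_of_nonneg hr, mul_one],
      by simp [hc0]⟩
  · have hn : ‖x‖ ≠ 0 := norm_ne_zero_iff.mpr hx0
    have hn' : 0 < ‖x‖ := by positivity
    have hle : 0 ≤ r ^ 2 - (c / ‖x‖) ^ 2 := by
      have : |c / ‖x‖| ≤ |r| := by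
        rw [abs_div, abs_norm, div_le_iff₀ hn', abs_of_nonneg hr]; exact hc
      have := sq_le_sq.mpr this
      linarith
    refine ⟨(c / ‖x‖ ^ 2) • x + √(r ^ 2 - (c / ‖x‖) ^ 2) • g,
      V.add_mem (V.smul_mem _ hx) (V.smul_mem _ hgV), ?_, ?_⟩
    · rw [← sq_eq_sq₀ (norm_nonneg _) hr, ← real_inner_self_eq_norm_sq]
      simp only [inner_add_left, inner_add_right, real_inner_smul_left, real_inner_smul_right,
        hgg, hgx, hxg]
      rw [real_inner_self_eq_norm_sq]
      have := Real.mul_self_sqrt hle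
      have e1 : c / ‖x‖ ^ 2 * (c / ‖x‖ ^ 2 * ‖x‖ ^ 2) = (c / ‖x‖) ^ 2 := by field_simp
      rw [e1]
      linarith
    · simp only [inner_add_left, real_inner_smul_left, hgx]
      rw [real_inner_self_eq_norm_sq]
      field_simp
      simp

/-- A subspace in `S` of dimension at least two can be enlarged by any member of `S` that is not
orthogonal to it. -/
theorem sup_span_subset (hS : IsReflectionClosed S) {V : Submodule ℝ E} (hV : (V : Set E) ⊆ S)
    {e f : E} (heV : e ∈ V) (hfV : f ∈ V) (he : inner ℝ e e = (1 : ℝ))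
    (hf : inner ℝ f f = (1 : ℝ)) (hef : inner ℝ e f = (0 : ℝ)) {p q : E} (hp : p ∈ V)
    (hq : q ∈ Vᗮ) (hp0 : p ≠ 0) (hpq : p + q ∈ S) :
    ((V ⊔ Submodule.span ℝ {p + q} : Submodule ℝ E) : Set E) ⊆ S := by
  suffices hall : ∀ x ∈ V, x + q ∈ S by
    intro z hz
    obtain ⟨y, hy, w, hw, rfl⟩ := Submodule.mem_sup.mp hz
    obtain ⟨c, rfl⟩ := Submodule.mem_span_singleton.mp hw
    by_cases hc : c = 0
    · simpa [hc] using hV hy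
    · have := hS.smul_mem c (hall (c⁻¹ • y + p) (V.add_mem (V.smul_mem _ hy) hp))
      convert this using 1
      simp only [smul_add, smul_smul, mul_inv_cancel₀ hc]
      module
  by_cases hq0 : q = 0
  · intro x hx
    simpa [hq0] using hV hx
  have hortho {x : E} (hx : x ∈ V) : inner ℝ x q = (0 : ℝ) :=
    (Submodule.mem_orthogonal V q).mp hq x hx
  have hortho' {x : E} (hx : x ∈ V) : inner ℝ q x = (0 : ℝ) := by
    rw [real_inner_comm]; exact hortho hx
  have hρ : 0 < ‖q‖ := norm_pos_iff.mpr hq0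
  set ρ := ‖q‖ with hρdef
  have hqq : inner ℝ q q = ρ ^ 2 := real_inner_self_eq_norm_sq q
  let T : ℝ → Prop := fun r => ∀ x ∈ V, ‖x‖ = r → x + q ∈ S
  have htransfer {y : E} (hy : y ∈ V) (hyS : y + q ∈ S) : T ‖y‖ := by
    intro x hx hxy
    by_cases hd : y - x = 0
    · rw [← sub_eq_zero.mp hd]; exact hyS
    have hdV : y - x ∈ V := V.sub_mem hy hx
    refine hS.mem_of_reflect_mem (hV hdV) hd ?_
    have hinner : 2 * inner ℝ (y - x) (x + q) = -(inner ℝ (y - x) (y - x) : ℝ) := by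
      simp only [inner_add_right, hortho hdV]
      simp only [inner_sub_left, inner_sub_right]
      have h1 : inner ℝ x x = inner ℝ y y := by
        rw [real_inner_self_eq_norm_sq, real_inner_self_eq_norm_sq, hxy]
      rw [h1, real_inner_comm x y]
      ring
    rw [hinner]
    convert hS.smul_mem (inner ℝ (y - x) (y - x)) hyS using 1
    module
  have hstep {r r' : ℝ} (hr : 0 < r) (hT : T r) (h : |r ^ 2 - ρ ^ 2| ≤ 2 * r * r') : T r' := by
    intro x hx hxr
    obtain ⟨y, hyV, hyr, hyx⟩ := exists_norm_eq_inner_eq heV hfV he hf hef hx hr.le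
      (c := (r ^ 2 - ρ ^ 2) / 2) (by rw [abs_div, abs_two, hxr]; linarith)
    refine hS.mem_of_reflect_mem (hT y hyV hyr) ?_ ?_
    · intro h0
      have := congrArg (fun z => inner ℝ q z) h0
      simp only [inner_add_right, hortho' hyV, hqq, inner_zero_right] at this
      nlinarith
    · apply hV
      have h1 : inner ℝ (y + q) (y + q) = r ^ 2 + ρ ^ 2 := by
        simp only [inner_add_right, inner_add_left, hortho' hyV, hortho hyV, hqq]
        rw [real_inner_self_eq_norm_sq, hyr]
        ring
      have h2 : inner ℝ (y + q) (x + q) = (r ^ 2 + ρ ^ 2) / 2 := by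
        simp only [inner_add_right, inner_add_left, hortho' hx, hortho hyV, hqq, hyx]
        ring
      rw [h1, h2]
      have h3 : (r ^ 2 + ρ ^ 2) • (x + q) - (2 * ((r ^ 2 + ρ ^ 2) / 2)) • (y + q)
          = (r ^ 2 + ρ ^ 2) • (x - y) := by module
      rw [h3]
      exact V.smul_mem _ (V.sub_mem hx hyV)
  have hpow (n : ℕ) : T (2 ^ n * ρ) → T ρ := by
    induction n with
    | zero => simp
    | succ n ih =>
      intro h
      refine ih (hstep (by positivity) h ?_)
      have h1 : (1 : ℝ) ≤ 2 ^ n := one_le_pow₀ (by norm_num)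
      rw [pow_succ (2 : ℝ) n]
      generalize (2 : ℝ) ^ n = t at h1
      have h2 : (t * 2 * ρ) ^ 2 - ρ ^ 2 = (4 * t ^ 2 - 1) * ρ ^ 2 := by ring
      rw [abs_of_nonneg]
      · nlinarith [sq_nonneg ρ]
      · rw [h2]
        have : 0 ≤ 4 * t ^ 2 - 1 := by nlinarith
        positivity
  have hpos : 0 < ‖p‖ := norm_pos_iff.mpr hp0
  have hTρ : T ρ := by
    obtain ⟨n, hn⟩ := pow_unbounded_of_one_lt (|‖p‖ ^ 2 - ρ ^ 2| / (2 * ‖p‖ * ρ))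
      (one_lt_two (α := ℝ))
    refine hpow n (hstep hpos (htransfer hp hpq) ?_)
    rw [div_lt_iff₀ (by positivity)] at hn
    linarith
  intro x hx
  exact hstep hρ hTρ (by simp; positivity) x hx rfl

/-- If `S` has two members whose angle is an irrational multiple of `π`, then they lie in a subspace
contained in `S` to which every other member of `S` is orthogonal. -/
theorem exists_subspace [FiniteDimensional ℝ E] (hS : IsReflectionClosed S) {x y : E}
    (hx : x ∈ S) (hy : y ∈ S) (hx0 : x ≠ 0) (hy0 : y ≠ 0)
    (h : Irrational (InnerProductGeometry.angle x y / Real.pi)) :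
    ∃ V : Submodule ℝ E, (V : Set E) ⊆ S ∧ x ∈ V ∧ y ∈ V ∧
      ∀ v ∈ S, ∀ w ∈ V, inner ℝ w v ≠ (0 : ℝ) → v ∈ V := by
  obtain ⟨W, hWS, hxW, hyW, e, heW, f, hfW, he, hf, hef⟩ := hS.exists_plane hx hy hx0 hy0 h
  obtain ⟨V, ⟨hVS, hWV⟩, hmax⟩ := exists_maximal_of_wellFoundedGT
    (fun V : Submodule ℝ E => (V : Set E) ⊆ S ∧ W ≤ V) ⟨W, hWS, le_rfl⟩
  refine ⟨V, hVS, hWV hxW, hWV hyW, fun v hv w hw hwv => ?_⟩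
  obtain ⟨p, hp, q, hq, rfl⟩ := Submodule.exists_add_mem_mem_orthogonal (K := V) v
  have hp0 : p ≠ 0 := by
    rintro rfl
    exact hwv (by simpa using (Submodule.mem_orthogonal V q).mp hq w hw)
  have hsup := hS.sup_span_subset hVS (hWV heW) (hWV hfW) he hf hef hp hq hp0 hv
  exact hmax ⟨hsup, hWV.trans le_sup_left⟩ le_sup_left
    (Submodule.mem_sup_right (Submodule.mem_span_singleton_self _))

end IsReflectionClosed

open Matrix in
/-- The Householder reflection along `v` as a matrix (the identity for `v = 0`). -/
noncomputable def householder {n : Type*} [Fintype n] [DecidableEq n] (v : n → ℝ) :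
    Matrix n n ℝ :=
  1 - (2 / (v ⬝ᵥ v)) • vecMulVec v v

section Householder

open Matrix

variable {n : Type*} [Fintype n] [DecidableEq n]

theorem householder_mulVec (v w : n → ℝ) :
    householder v *ᵥ w = w - (2 / (v ⬝ᵥ v) * (v ⬝ᵥ w)) • v := by
  rw [householder, sub_mulVec, one_mulVec, smul_mulVec, vecMulVec_mulVec, op_smul_eq_smul,
    smul_smul]

theorem householder_zero : householder (0 : n → ℝ) = 1 := by
  simp [householder]

theorem householder_transpose (v : n → ℝ) : (householder v)ᵀ = householder v := by
  simp [householder, transpose_vecMulVec]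

theorem householder_mul_self (v : n → ℝ) : householder v * householder v = 1 := by
  by_cases hv : v ⬝ᵥ v = 0
  · simp [householder, hv]
  · simp only [householder, sub_mul, mul_sub, one_mul, mul_one, smul_mul_smul_comm,
      vecMulVec_mul_vecMulVec, vecMulVec_smul, smul_smul]
    have : 2 / (v ⬝ᵥ v) * (2 / (v ⬝ᵥ v)) * (v ⬝ᵥ v) = 2 * (2 / (v ⬝ᵥ v)) := by field_simp
    rw [this]
    module

theorem householder_smul {c : ℝ} (hc : c ≠ 0) (v : n → ℝ) :
    householder (c • v) = householder v := by
  simp only [householder, dotProduct_smul, smul_dotProduct, vecMulVec_smul, smul_vecMulVec,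
    smul_smul, smul_eq_mul]
  congr 2
  by_cases hv : v ⬝ᵥ v = 0
  · simp [hv]
  · field_simp

theorem householder_conj {Q : Matrix n n ℝ} (hQ : Qᵀ * Q = 1) (w : n → ℝ) :
    Q * householder w * Qᵀ = householder (Q *ᵥ w) := by
  have hdot : (Q *ᵥ w) ⬝ᵥ (Q *ᵥ w) = w ⬝ᵥ w := by
    rw [dotProduct_mulVec, vecMul_mulVec, hQ, vecMul_one]
  simp only [householder, mul_sub, sub_mul, mul_one, Matrix.mul_smul, Matrix.smul_mul, mul_vecMulVec,
    vecMulVec_mul, vecMul_transpose, hdot, mul_eq_one_comm.mp hQ]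

/-- The Householder reflection along `v` as an orthogonal matrix. -/
noncomputable def householderO (v : n → ℝ) : Matrix.orthogonalGroup n ℝ :=
  ⟨householder v, (mem_orthogonalGroup_iff n ℝ).mpr
    (by rw [householder_transpose, householder_mul_self])⟩

theorem coe_householderO (v : n → ℝ) : (householderO v : Matrix n n ℝ) = householder v := rfl

theorem householderO_mulVec (v w : n → ℝ) :
    householderO (householder v *ᵥ w) = householderO v * householderO w * householderO v := by
  apply Subtype.ext
  rw [Submonoid.coe_mul, Submonoid.coe_mul, coe_householderO, coe_householderO, coe_householderO,
    ← householder_conj (by rw [householder_transpose, householder_mul_self]),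
    householder_transpose]

theorem continuousAt_householderO {v : n → ℝ} (hv : v ≠ 0) :
    ContinuousAt (householderO (n := n)) v := by
  rw [Topology.IsInducing.subtypeVal.continuousAt_iff]
  have hv' : v ⬝ᵥ v ≠ 0 := by rwa [ne_eq, dotProduct_self_eq_zero]
  have h1 : Continuous fun w : n → ℝ => w ⬝ᵥ w := continuous_id.dotProduct continuous_id
  have h2 : Continuous fun w : n → ℝ => vecMulVec w w := continuous_id.matrix_vecMulVec continuous_id
  exact continuousAt_const.sub ((continuousAt_const.div h1.continuousAt hv').smul h2.continuousAt)

theorem dotProduct_mulVec_orthogonal (A : Matrix.orthogonalGroup n ℝ) (v w : n → ℝ) :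
    ((A : Matrix n n ℝ) *ᵥ v) ⬝ᵥ ((A : Matrix n n ℝ) *ᵥ w) = v ⬝ᵥ w := by
  have h : (A : Matrix n n ℝ)ᵀ * (A : Matrix n n ℝ) = 1 :=
    (mem_orthogonalGroup_iff' n ℝ).mp A.2
  rw [dotProduct_mulVec, vecMul_mulVec, h, vecMul_one]

/-- The Householder reflection along `v - w` swaps `v` and `w` if they have the same norm. -/
theorem householder_sub_mulVec {v w : n → ℝ} (h : v ⬝ᵥ v = w ⬝ᵥ w) :
    householder (v - w) *ᵥ v = w := by
  by_cases hvw : v - w = 0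
  · rw [hvw, householder_zero, one_mulVec, sub_eq_zero.mp hvw]
  have h0 : (v - w) ⬝ᵥ (v - w) ≠ 0 := by rwa [ne_eq, dotProduct_self_eq_zero]
  have h1 : 2 * ((v - w) ⬝ᵥ v) = (v - w) ⬝ᵥ (v - w) := by
    simp only [sub_dotProduct, dotProduct_sub]
    rw [dotProduct_comm v w, ← h]
    ring
  rw [householder_mulVec, div_mul_eq_mul_div, h1, div_self h0, one_smul, sub_sub_cancel]

/-- A subgroup of the orthogonal group that contains all Householder reflections is everything. -/
theorem eq_top_of_householderO_mem {H : Subgroup (Matrix.orthogonalGroup n ℝ)}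
    (h : ∀ v, householderO v ∈ H) : H = ⊤ := by
  rw [eq_top_iff]
  rintro A -
  have key (s : Finset n) : ∃ B ∈ H, ∀ i ∈ s,
      ((B * A : Matrix.orthogonalGroup n ℝ) : Matrix n n ℝ) *ᵥ Pi.single i 1 = Pi.single i 1 := by
    induction s using Finset.induction_on with
    | empty => exact ⟨1, H.one_mem, by simp⟩
    | insert j s hj ih =>
      obtain ⟨B, hB, hBA⟩ := ih
      set C := B * A with hC
      set x := (C : Matrix n n ℝ) *ᵥ Pi.single j 1 with hx
      refine ⟨householderO (x - Pi.single j 1) * B, H.mul_mem (h _) hB, fun i hi => ?_⟩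
      rw [mul_assoc, Submonoid.coe_mul, coe_householderO, ← mulVec_mulVec, ← hC]
      rcases Finset.mem_insert.mp hi with rfl | hi
      · exact householder_sub_mulVec (dotProduct_mulVec_orthogonal C _ _)
      · have h0 : (x - Pi.single j 1) ⬝ᵥ Pi.single i 1 = 0 := by
          rw [sub_dotProduct, sub_eq_zero]
          conv_lhs => rw [← hBA i hi]
          exact dotProduct_mulVec_orthogonal C _ _
        rw [hBA i hi, householder_mulVec, h0]
        simp
  obtain ⟨B, hB, hBA⟩ := key Finset.univ
  have h1 : B * A = 1 := by
    apply Subtype.ext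
    apply Matrix.ext_of_mulVec_single
    intro i
    rw [hBA i (Finset.mem_univ i)]
    exact (one_mulVec _).symm
  rw [← inv_eq_of_mul_eq_one_right h1]
  exact H.inv_mem hB

/-- The vectors whose reflections lie in a closed subgroup of the orthogonal group. -/
theorem isReflectionClosed_householderO {H : Subgroup (Matrix.orthogonalGroup n ℝ)}
    (hH : IsClosed (H : Set (Matrix.orthogonalGroup n ℝ))) :
    IsReflectionClosed {v : EuclideanSpace ℝ n | householderO v.ofLp ∈ H} where
  isClosed := by
    rw [← isOpen_compl_iff, isOpen_iff_mem_nhds]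
    intro v hv
    have hv0 : v.ofLp ≠ 0 := by
      intro h0
      apply hv
      have : householderO (0 : n → ℝ) = 1 := Subtype.ext householder_zero
      rw [Set.mem_ofPred_eq, h0, this]
      exact H.one_mem
    have hcont : ContinuousAt (fun w : EuclideanSpace ℝ n => householderO w.ofLp) v :=
      (continuousAt_householderO hv0).comp (PiLp.continuous_ofLp 2 _).continuousAt
    exact hcont.preimage_mem_nhds (hH.isOpen_compl.mem_nhds hv)
  smul_mem := by
    intro c v hv
    by_cases hc : c = 0
    · have : householderO (0 : n → ℝ) = 1 := Subtype.ext householder_zero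
      simp [hc, this, H.one_mem]
    · have : householderO (c • v.ofLp) = householderO v.ofLp :=
        Subtype.ext (householder_smul hc _)
      simpa [this] using hv
  reflect_mem := by
    intro v w hv hw
    by_cases hv0 : v = 0
    · have : householderO (0 : n → ℝ) = 1 := Subtype.ext householder_zero
      simp [hv0, this, H.one_mem]
    · have hdot : v.ofLp ⬝ᵥ v.ofLp ≠ 0 := by
        rw [ne_eq, dotProduct_self_eq_zero]
        simpa using hv0
      have h : ((inner ℝ v v : ℝ) • w - (2 * inner ℝ v w : ℝ) • v).ofLp
          = (v.ofLp ⬝ᵥ v.ofLp) • (householder v.ofLp *ᵥ w.ofLp) := by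
        simp only [EuclideanSpace.inner_eq_star_dotProduct, star_trivial, WithLp.ofLp_sub,
          WithLp.ofLp_smul, householder_mulVec, smul_sub, smul_smul]
        rw [dotProduct_comm w.ofLp]
        congr 2
        field_simp
      have h' : householderO ((v.ofLp ⬝ᵥ v.ofLp) • (householder v.ofLp *ᵥ w.ofLp))
          = householderO v.ofLp * householderO w.ofLp * householderO v.ofLp :=
        (Subtype.ext (householder_smul hdot _)).trans (householderO_mulVec _ _)
      rw [Set.mem_ofPred_eq, h, h']
      exact H.mul_mem (H.mul_mem hv hw) hv

end Householder

/-- The vector along which the beamsplitter on coordinates `i` and `j` reflects. -/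
noncomputable def beamsplitterVec {m : ℕ} (α β : ℝ) (i j : Fin m) : EuclideanSpace ℝ (Fin m) :=
  EuclideanSpace.single i β - EuclideanSpace.single j (1 + α)

theorem inner_beamsplitterVec {m : ℕ} (α β : ℝ) (i j : Fin m) (x : EuclideanSpace ℝ (Fin m)) :
    inner ℝ (beamsplitterVec α β i j) x = β * x i - (1 + α) * x j := by
  simp [beamsplitterVec, inner_sub_left, EuclideanSpace.inner_single_left]

theorem beamsplitterVec_apply {m : ℕ} (α β : ℝ) (i j k : Fin m) :
    beamsplitterVec α β i j k = (if k = i then β else 0) - (if k = j then 1 + α else 0) := by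
  simp [beamsplitterVec]

theorem householder_beamsplitterVec {m : ℕ} {α β : ℝ} (hnorm : α ^ 2 + β ^ 2 = 1)
    (hα : 1 + α ≠ 0) {i j : Fin m} (hij : i ≠ j) :
    householder (beamsplitterVec α β i j).ofLp = realBeamsplitterOn α β i j := by
  have hdot : (beamsplitterVec α β i j).ofLp ⬝ᵥ (beamsplitterVec α β i j).ofLp
      = 2 * (1 + α) := by
    have h := EuclideanSpace.inner_eq_star_dotProduct (beamsplitterVec α β i j)
      (beamsplitterVec α β i j)
    rw [star_trivial, inner_beamsplitterVec, beamsplitterVec_apply, beamsplitterVec_apply] at h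
    rw [← h]
    simp only [hij, hij.symm, if_true, if_false]
    linear_combination hnorm
  have hdiv : 2 / (2 * (1 + α)) = (1 + α)⁻¹ := by field_simp
  ext k l
  rw [householder, hdot, hdiv]
  simp only [Matrix.sub_apply, Matrix.smul_apply, Matrix.vecMulVec_apply, beamsplitterVec_apply,
    realBeamsplitterOn, Matrix.of_apply, Matrix.one_apply, smul_eq_mul]
  by_cases hki : k = i <;> by_cases hkj : k = j <;> by_cases hli : l = i <;>
    by_cases hlj : l = j <;> subst_vars <;>
    simp_all [eq_comm] <;> field_simp <;>
    first | ring1 | linear_combination hnorm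

/-- Among three coordinates, some pair of beamsplitter vectors encloses an angle that is an
irrational multiple of `π`. -/
theorem irrational_angle_beamsplitterVec {m : ℕ} {α β : ℝ} (hnorm : α ^ 2 + β ^ 2 = 1)
    (hα : α ≠ 0) (hβ : β ≠ 0) {i j k : Fin m} (hij : i ≠ j) (hik : i ≠ k) (hjk : j ≠ k) :
    Irrational (InnerProductGeometry.angle (beamsplitterVec α β i j) (beamsplitterVec α β i k)
        / Real.pi) ∨
      Irrational (InnerProductGeometry.angle (beamsplitterVec α β j k) (beamsplitterVec α β i k)
        / Real.pi) := by
  have hβ2 : 0 < β ^ 2 := by positivity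
  have hlt : |α| < 1 := by
    rw [← sq_lt_one_iff_abs_lt_one]; linarith
  have h1 : 0 < 1 + α := by linarith [(abs_lt.mp hlt).1]
  have hn {a b : Fin m} (hab : a ≠ b) : ‖beamsplitterVec α β a b‖ ^ 2 = 2 * (1 + α) := by
    rw [← real_inner_self_eq_norm_sq, inner_beamsplitterVec, beamsplitterVec_apply,
      beamsplitterVec_apply]
    simp only [hab, hab.symm, if_true, if_false]
    linear_combination hnorm
  have hnn {a b c d : Fin m} (hab : a ≠ b) (hcd : c ≠ d) :
      ‖beamsplitterVec α β a b‖ * ‖beamsplitterVec α β c d‖ = 2 * (1 + α) := by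
    have : ‖beamsplitterVec α β a b‖ = ‖beamsplitterVec α β c d‖ := by
      rw [← sq_eq_sq₀ (norm_nonneg _) (norm_nonneg _), hn hab, hn hcd]
    rw [this, ← sq, hn hcd]
  apply irrational_angle_of_two_cos hα hlt
  · rw [InnerProductGeometry.cos_angle, hnn hij hik, inner_beamsplitterVec,
      beamsplitterVec_apply, beamsplitterVec_apply]
    simp only [hij.symm, hik, hjk, if_true, if_false]
    field_simp
    linear_combination hnorm
  · rw [InnerProductGeometry.cos_angle, hnn hjk hik, inner_beamsplitterVec,
      beamsplitterVec_apply, beamsplitterVec_apply]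
    simp only [hij.symm, hik.symm, hjk, if_true, if_false]
    field_simp
    ring

/-- A subspace that contains one beamsplitter vector, and every beamsplitter vector it is not
orthogonal to, is everything. -/
theorem eq_top_of_beamsplitterVec_mem {m : ℕ} {α β : ℝ} (hnorm : α ^ 2 + β ^ 2 = 1)
    (hα : α ≠ 0) (hβ : β ≠ 0) (hm : 3 ≤ m) {V : Submodule ℝ (EuclideanSpace ℝ (Fin m))}
    (h0 : beamsplitterVec α β ⟨0, by omega⟩ ⟨2, by omega⟩ ∈ V)
    (hV : ∀ i j : Fin m, i < j → ∀ w ∈ V,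
      inner ℝ w (beamsplitterVec α β i j) ≠ (0 : ℝ) → beamsplitterVec α β i j ∈ V) :
    V = ⊤ := by
  have hα1 : 1 + α ≠ 0 := by
    intro h
    have : β ^ 2 = 0 := by linear_combination hnorm - (α - 1) * h
    exact hβ (pow_eq_zero_iff (two_ne_zero) |>.mp this)
  set z : Fin m := ⟨0, by omega⟩ with hz
  set o : Fin m := ⟨1, by omega⟩ with ho
  set t : Fin m := ⟨2, by omega⟩ with ht
  have hzt : z ≠ t := by simp [hz, ht]
  have hzo : z < o := by simp [hz, ho, Fin.lt_def]
  have hot : o < t := by simp [ho, ht, Fin.lt_def]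
  have hzj {j : Fin m} (hj : z < j) : beamsplitterVec α β z j ∈ V := by
    by_cases hjt : j = t
    · rw [hjt]; exact h0
    refine hV z j hj _ h0 ?_
    rw [inner_beamsplitterVec, beamsplitterVec_apply, beamsplitterVec_apply]
    simp only [hj.ne, hzt.symm, Ne.symm hjt, if_true, if_false]
    simpa using hβ
  have hall {i j : Fin m} (hij : i < j) : beamsplitterVec α β i j ∈ V := by
    by_cases hiz : i = z
    · rw [hiz] at hij ⊢; exact hzj hij
    have hzi : z < i := by
      rw [Fin.lt_def]
      have : (i : ℕ) ≠ 0 := fun h => hiz (Fin.ext h)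
      simp only [hz]; omega
    refine hV i j hij _ (hzj (hzi.trans hij)) ?_
    rw [inner_beamsplitterVec, beamsplitterVec_apply, beamsplitterVec_apply]
    simp only [(hzi.trans hij).ne, hij.ne', Ne.symm hiz, if_true, if_false]
    intro h
    exact mul_ne_zero hα1 hα1 (by linear_combination h)
  rw [← Submodule.orthogonal_eq_bot_iff, Submodule.eq_bot_iff]
  intro x hx
  have hrel {i j : Fin m} (hij : i < j) : β * x i = (1 + α) * x j := by
    have := (Submodule.mem_orthogonal V x).mp hx _ (hall hij)
    rw [inner_beamsplitterVec] at this
    linarith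
  have hxo : x z = x o := by
    have := (hrel (hzo.trans hot)).trans (hrel hot).symm
    exact mul_left_cancel₀ hβ this
  have hxz : x z = 0 := by
    have h1 := hrel hzo
    rw [← hxo] at h1
    have h2 : (β - (1 + α)) * x z = 0 := by linear_combination h1
    refine (mul_eq_zero.mp h2).resolve_left fun h3 => ?_
    have h4 : β = 1 + α := by linarith
    rw [h4] at hnorm
    exact mul_ne_zero hα hα1 (by linarith)
  ext j
  rcases (Fin.le_def.mpr (Nat.zero_le _) : z ≤ j).eq_or_lt with rfl | hj
  · exact hxz
  · have := hrel hj
    rw [hxz, mul_zero] at this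
    exact (mul_eq_zero.mp this.symm).resolve_left hα1

/-- For any nontrivial real beamsplitter `b = [[α, β], [β, -α]]`
(`α² + β² = 1`, `α ≠ 0`, `β ≠ 0`) and any `m ≥ 3`, the subgroup of `O(m)` generated by
all the matrices `b_{ij}` for `i < j` is dense in `O(m)`. -/
theorem real_beamsplitter_dense_in_Om
    (m : ℕ) (hm : 3 ≤ m)
    (α β : ℝ) (hnorm : α ^ 2 + β ^ 2 = 1) (hα : α ≠ 0) (hβ : β ≠ 0) :
    Dense ((Subgroup.closure
        {A : Matrix.orthogonalGroup (Fin m) ℝ | ∃ i j : Fin m, i < j ∧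
          (A : Matrix (Fin m) (Fin m) ℝ) = realBeamsplitterOn α β i j} :
        Subgroup (Matrix.orthogonalGroup (Fin m) ℝ)) :
      Set (Matrix.orthogonalGroup (Fin m) ℝ)) := by
  have hβ2 : 0 < β ^ 2 := by positivity
  have hα1 : 1 + α ≠ 0 := by
    have : |α| < 1 := by rw [← sq_lt_one_iff_abs_lt_one]; linarith
    linarith [(abs_lt.mp this).1]
  set G := Subgroup.closure
        {A : Matrix.orthogonalGroup (Fin m) ℝ | ∃ i j : Fin m, i < j ∧
          (A : Matrix (Fin m) (Fin m) ℝ) = realBeamsplitterOn α β i j} with hG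
  let H : Subgroup (Matrix.orthogonalGroup (Fin m) ℝ) := G.topologicalClosure
  have hS := isReflectionClosed_householderO (H := H) G.isClosed_topologicalClosure
  set S := {v : EuclideanSpace ℝ (Fin m) | householderO v.ofLp ∈ H} with hSdef
  have hmem {i j : Fin m} (hij : i < j) : beamsplitterVec α β i j ∈ S :=
    G.le_topologicalClosure
      (Subgroup.subset_closure ⟨i, j, hij, householder_beamsplitterVec hnorm hα1 hij.ne⟩)
  have hne {i j : Fin m} (hij : i < j) : beamsplitterVec α β i j ≠ 0 := by
    intro h
    have := congrArg (fun v : EuclideanSpace ℝ (Fin m) => v i) h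
    simp only [beamsplitterVec_apply, hij.ne, if_true, if_false] at this
    exact hβ (by simpa using this)
  let z : Fin m := ⟨0, by omega⟩
  let o : Fin m := ⟨1, by omega⟩
  let t : Fin m := ⟨2, by omega⟩
  have hzo : z < o := by simp [z, o, Fin.lt_def]
  have hot : o < t := by simp [o, t, Fin.lt_def]
  have hzt : z < t := hzo.trans hot
  obtain ⟨V, hVS, hztV, hmax⟩ : ∃ V : Submodule ℝ (EuclideanSpace ℝ (Fin m)),
      (V : Set (EuclideanSpace ℝ (Fin m))) ⊆ S ∧ beamsplitterVec α β z t ∈ V ∧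
      ∀ v ∈ S, ∀ w ∈ V, inner ℝ w v ≠ (0 : ℝ) → v ∈ V := by
    rcases irrational_angle_beamsplitterVec hnorm hα hβ hzo.ne hzt.ne hot.ne with h | h
    · obtain ⟨V, h1, -, h2, h3⟩ :=
        hS.exists_subspace (hmem hzo) (hmem hzt) (hne hzo) (hne hzt) h
      exact ⟨V, h1, h2, h3⟩
    · obtain ⟨V, h1, -, h2, h3⟩ :=
        hS.exists_subspace (hmem hot) (hmem hzt) (hne hot) (hne hzt) h
      exact ⟨V, h1, h2, h3⟩
  have hVtop : V = ⊤ := eq_top_of_beamsplitterVec_mem hnorm hα hβ hm hztV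
    fun i j hij => hmax _ (hmem hij)
  have hHtop : H = ⊤ := eq_top_of_householderO_mem fun v =>
    hVS (hVtop ▸ Submodule.mem_top : WithLp.toLp 2 v ∈ V)
  rw [dense_iff_closure_eq, ← Subgroup.topologicalClosure_coe]
  exact congrArg (fun K : Subgroup (Matrix.orthogonalGroup (Fin m) ℝ) => (K : Set (Matrix.orthogonalGroup (Fin m) ℝ))) hHtop
end

section
/- Let g be a nontrivial two-mode optical gate, i.e. a 2×2 unitary matrix g = [[a, b],[c, d]] with all four entries nonzero, and let m ≥ 3. Then the topological closure of the subgroup of U(m) generated by all the matrices g_{ij} (for 1 ≤ i < j ≤ m) together with all phaseshifters (diagonal m×m unitary matrices with entries e^{iθ} in one coordinate and 1 in the others, for all θ ∈ ℝ and all coordinates) contains every m×m special unitary matrix. -/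
/-- The m×m matrix obtained by applying the 2×2 gate `g` to coordinates `i` and `j`
(with `i < j`) and the identity on all other coordinates. -/
def gateOn {m : ℕ} (g : Matrix (Fin 2) (Fin 2) ℂ) (i j : Fin m) : Matrix (Fin m) (Fin m) ℂ :=
  Matrix.of fun k l =>
    if k = i ∧ l = i then g 0 0
    else if k = i ∧ l = j then g 0 1
    else if k = j ∧ l = i then g 1 0
    else if k = j ∧ l = j then g 1 1
    else if k = l then 1 else 0

/-- The m×m phaseshifter acting on mode `k` with phase `θ`: diagonal, with `e^{iθ}` in the
`k`-th diagonal entry and `1` elsewhere. -/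
noncomputable def phaseShifter {m : ℕ} (θ : ℝ) (k : Fin m) : Matrix (Fin m) (Fin m) ℂ :=
  Matrix.diagonal fun l => if l = k then Complex.exp (θ * Complex.I) else 1

section Helpers

open Matrix

theorem gateOn_mulVec {m : ℕ} (g : Matrix (Fin 2) (Fin 2) ℂ) {i j : Fin m} (hij : i ≠ j)
    (v : Fin m → ℂ) (k : Fin m) :
    (gateOn g i j *ᵥ v) k =
      if k = i then g 0 0 * v i + g 0 1 * v j
      else if k = j then g 1 0 * v i + g 1 1 * v j else v k := by
  have key (a b : ℂ) : ∑ l, (if l = i then a else if l = j then b else 0) * v l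
      = a * v i + b * v j := by
    have h (l : Fin m) : (if l = i then a else if l = j then b else 0) * v l
        = (if l = i then a * v l else 0) + (if l = j then b * v l else 0) := by
      split_ifs with h₁ h₂
      · exact absurd (h₁.symm.trans h₂) hij
      all_goals simp
    simp [h, Finset.sum_add_distrib]
  by_cases hki : k = i
  · subst hki
    rw [if_pos rfl, ← key, mulVec, dotProduct]
    refine Finset.sum_congr rfl fun l _ => ?_
    congr 1
    simp only [gateOn, of_apply]
    grind
  · by_cases hkj : k = j
    · subst hkj
      rw [if_neg hki, if_pos rfl, ← key, mulVec, dotProduct]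
      refine Finset.sum_congr rfl fun l _ => ?_
      congr 1
      simp only [gateOn, of_apply]
      grind
    · simp [mulVec, dotProduct, gateOn, hki, hkj]

theorem gateOn_mul {m : ℕ} (g h : Matrix (Fin 2) (Fin 2) ℂ) {i j : Fin m} (hij : i ≠ j) :
    gateOn (g * h) i j = gateOn g i j * gateOn h i j := by
  refine ext_of_mulVec_single fun l => ?_
  rw [← mulVec_mulVec]
  ext k
  simp only [gateOn_mulVec _ hij, Matrix.mul_apply, Fin.sum_univ_two, if_neg hij.symm, if_true]
  split_ifs <;> ring

theorem gateOn_one {m : ℕ} (i j : Fin m) :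
    gateOn (1 : Matrix (Fin 2) (Fin 2) ℂ) i j = 1 := by
  ext k l
  simp only [gateOn, of_apply, Matrix.one_apply]
  grind

theorem star_gateOn {m : ℕ} (g : Matrix (Fin 2) (Fin 2) ℂ) (i j : Fin m) :
    star (gateOn g i j) = gateOn (star g) i j := by
  ext k l
  simp only [gateOn, of_apply, Matrix.star_apply, apply_ite star, star_one, star_zero]
  grind

/-- Applying a two-mode gate to two distinct modes, as a homomorphism of unitary groups. -/
def gateHom {m : ℕ} {i j : Fin m} (hij : i ≠ j) :
    unitaryGroup (Fin 2) ℂ →* unitaryGroup (Fin m) ℂ where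
  toFun g := ⟨gateOn (g : Matrix (Fin 2) (Fin 2) ℂ) i j, by
    rw [mem_unitaryGroup_iff, star_gateOn, ← gateOn_mul _ _ hij,
      mem_unitaryGroup_iff.1 g.2, gateOn_one i j]⟩
  map_one' := Subtype.ext (gateOn_one i j)
  map_mul' g h := Subtype.ext (gateOn_mul _ _ hij)

theorem phaseShifter_mem_unitaryGroup {m : ℕ} (θ : ℝ) (k : Fin m) :
    phaseShifter θ k ∈ unitaryGroup (Fin m) ℂ := by
  rw [mem_unitaryGroup_iff, phaseShifter, star_eq_conjTranspose, diagonal_conjTranspose,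
    diagonal_mul_diagonal, ← diagonal_one]
  congr 1
  ext l
  by_cases h : l = k
  · simp [h, Complex.mul_conj, Complex.normSq_eq_norm_sq, Complex.norm_exp_ofReal_mul_I]
  · simp [h]

theorem gateOn_phaseShifter_zero {m : ℕ} (θ : ℝ) (i j : Fin m) :
    gateOn (phaseShifter θ (0 : Fin 2)) i j = phaseShifter θ i := by
  ext k l
  simp only [gateOn, phaseShifter, of_apply, diagonal_apply]
  grind

theorem exists_exp_mul_eq {z w : ℂ} (h : ‖z‖ = ‖w‖) :
    ∃ θ : ℝ, Complex.exp (θ * Complex.I) * z = w := by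
  have hz := Complex.norm_mul_exp_arg_mul_I z
  have hw := Complex.norm_mul_exp_arg_mul_I w
  have hn : (‖z‖ : ℂ) = ‖w‖ := congrArg _ h
  have he : Complex.exp ((w.arg - z.arg : ℝ) * Complex.I) * Complex.exp (z.arg * Complex.I)
      = Complex.exp (w.arg * Complex.I) := by
    rw [← Complex.exp_add]
    push_cast
    ring_nf
  refine ⟨w.arg - z.arg, ?_⟩
  linear_combination (-Complex.exp ((w.arg - z.arg : ℝ) * Complex.I)) * hz + hw + ‖z‖ * he
    + Complex.exp (w.arg * Complex.I) * hn

theorem exists_norm_exp_mul_add_eq {z w : ℂ} (h : ‖z‖ = ‖w‖) {s : ℝ} (hs : 0 ≤ s)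
    (hs' : s ≤ 2 * ‖w‖) : ∃ θ : ℝ, ‖Complex.exp (θ * Complex.I) * z + w‖ = s := by
  obtain ⟨θ₀, h₀⟩ := exists_exp_mul_eq (w := -w) (h.trans (norm_neg w).symm)
  obtain ⟨θ₁, h₁⟩ := exists_exp_mul_eq h
  have hc : Continuous fun θ : ℝ => ‖Complex.exp (θ * Complex.I) * z + w‖ := by fun_prop
  refine mem_range_of_exists_le_of_exists_ge hc ⟨θ₀, ?_⟩ ⟨θ₁, ?_⟩
  · simpa [h₀] using hs
  · simpa [h₁, ← two_mul] using hs'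

theorem Icc_subset_of_doubling {T : Set ℝ}
    (hT : ∀ t ∈ T, ∀ s, 0 ≤ s → s ≤ 4 * t * (1 - t) → s ∈ T)
    (hne : ∃ t ∈ T, 0 < t ∧ t < 1) : Set.Icc 0 1 ⊆ T := by
  obtain ⟨t, ht, ht0, ht1⟩ := hne
  have hpos : 0 < 4 * t * (1 - t) := by nlinarith [mul_pos ht0 (sub_pos.2 ht1)]
  have hmin (n : ℕ) : min (1 / 2) (2 ^ n * (4 * t * (1 - t))) ∈ T := by
    induction n with
    | zero => exact hT t ht _ (by positivity) (by simp)
    | succ n ih =>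
      have hx : 0 < 2 ^ n * (4 * t * (1 - t)) := by positivity
      rw [pow_succ]
      set x := 2 ^ n * (4 * t * (1 - t)) with hxdef
      rw [show (2 : ℝ) ^ n * 2 * (4 * t * (1 - t)) = 2 * x by rw [hxdef]; ring]
      refine hT _ ih _ (by positivity) ?_
      rcases le_total (1 / 2) x with h | h
      · rw [min_eq_left h]
        exact (min_le_left _ _).trans (by norm_num)
      · rw [min_eq_right h]
        exact (min_le_right _ _).trans (by nlinarith)
  obtain ⟨n, hn⟩ := pow_unbounded_of_one_lt (1 / (4 * t * (1 - t))) (one_lt_two (α := ℝ))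
  have hhalf : (1 / 2 : ℝ) ∈ T := by
    have := hmin n
    rw [div_lt_iff₀ hpos] at hn
    rwa [min_eq_left (by linarith)] at this
  exact fun s hs => hT _ hhalf s hs.1 (by linarith [hs.2])

theorem norm_sq_add_norm_sq_row (h : unitaryGroup (Fin 2) ℂ) (p : Fin 2) :
    ‖h.1 p 0‖ ^ 2 + ‖h.1 p 1‖ ^ 2 = 1 := by
  have := congrFun (congrFun (mem_unitaryGroup_iff.1 h.2) p) p
  simp only [Matrix.mul_apply, Fin.sum_univ_two, Matrix.star_apply, Complex.star_def,
    Complex.mul_conj, Matrix.one_apply_eq, Complex.normSq_eq_norm_sq] at this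
  exact_mod_cast this

theorem norm_sq_add_norm_sq_col (h : unitaryGroup (Fin 2) ℂ) (p : Fin 2) :
    ‖h.1 0 p‖ ^ 2 + ‖h.1 1 p‖ ^ 2 = 1 := by
  simpa [Matrix.star_apply] using norm_sq_add_norm_sq_row (star h) p

section TwoModes

variable {K : Subgroup (unitaryGroup (Fin 2) ℂ)}

theorem exists_norm_sq_entry_eq
    (hK : ∀ θ : ℝ, (⟨phaseShifter θ 0, phaseShifter_mem_unitaryGroup θ 0⟩ :
      unitaryGroup (Fin 2) ℂ) ∈ K)
    {g : unitaryGroup (Fin 2) ℂ} (hg : g ∈ K) (hne : ∀ i j, g.1 i j ≠ 0)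
    {t : ℝ} (ht : t ∈ Set.Icc (0 : ℝ) 1) : ∃ h ∈ K, ‖h.1 1 0‖ ^ 2 = t := by
  have main : Set.Icc (0 : ℝ) 1 ⊆ {t | ∃ h ∈ K, ‖h.1 1 0‖ ^ 2 = t} := by
    refine Icc_subset_of_doubling ?_ ⟨_, ⟨g, hg, rfl⟩, ?_, ?_⟩
    · rintro t ⟨h, hh, rfl⟩ s hs hs'
      have hr := norm_sq_add_norm_sq_row h 1
      have hc := norm_sq_add_norm_sq_col h 0
      have hn : ‖h.1 0 0‖ = ‖h.1 1 1‖ := by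
        rw [← sq_eq_sq₀ (norm_nonneg _) (norm_nonneg _)]
        linarith
      rcases eq_or_ne (h.1 1 0) 0 with h0 | h0
      · have : s = 0 := by
          rw [h0] at hs'
          simp at hs'
          linarith
        exact ⟨h, hh, by simp [h0, this]⟩
      have hpos : 0 < ‖h.1 1 0‖ := norm_pos_iff.2 h0
      obtain ⟨θ, hθ⟩ := exists_norm_exp_mul_add_eq hn
        (s := Real.sqrt s / ‖h.1 1 0‖) (by positivity) (by
          rw [div_le_iff₀ hpos, Real.sqrt_le_left (by positivity)]
          calc s ≤ _ := hs'
            _ = _ := by rw [show 1 - ‖h.1 1 0‖ ^ 2 = ‖h.1 1 1‖ ^ 2 by linarith]; ring)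
      refine ⟨h * ⟨phaseShifter θ 0, phaseShifter_mem_unitaryGroup θ 0⟩ * h,
        K.mul_mem (K.mul_mem hh (hK θ)) hh, ?_⟩
      have he : (h * ⟨phaseShifter θ 0, phaseShifter_mem_unitaryGroup θ 0⟩ * h).1 1 0
          = h.1 1 0 * (Complex.exp (θ * Complex.I) * h.1 0 0 + h.1 1 1) := by
        simp [phaseShifter, Matrix.mul_apply, Fin.sum_univ_two]
        ring
      rw [he, norm_mul, hθ, mul_div_cancel₀ _ hpos.ne', Real.sq_sqrt hs]
    · have := norm_pos_iff.2 (hne 1 0)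
      positivity
    · have := norm_pos_iff.2 (hne 1 1)
      have h2 := norm_sq_add_norm_sq_row g 1
      nlinarith
  exact main ht

theorem exists_mulVec_apply_eq_zero
    (hK : ∀ θ : ℝ, (⟨phaseShifter θ 0, phaseShifter_mem_unitaryGroup θ 0⟩ :
      unitaryGroup (Fin 2) ℂ) ∈ K)
    {g : unitaryGroup (Fin 2) ℂ} (hg : g ∈ K) (hne : ∀ i j, g.1 i j ≠ 0)
    (x y : ℂ) (p : Fin 2) : ∃ h ∈ K, h.1 p 0 * x + h.1 p 1 * y = 0 := by
  have hrow {t : ℝ} (ht : t ∈ Set.Icc (0 : ℝ) 1) : ∃ h ∈ K, ‖h.1 p 0‖ ^ 2 = t := by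
    fin_cases p
    · obtain ⟨h, hh, he⟩ := exists_norm_sq_entry_eq hK hg hne
        (t := 1 - t) ⟨by linarith [ht.2], by linarith [ht.1]⟩
      have := norm_sq_add_norm_sq_col h 0
      exact ⟨h, hh, by simp only [Fin.zero_eta]; linarith⟩
    · exact exists_norm_sq_entry_eq hK hg hne ht
  by_cases hxy : ‖x‖ ^ 2 + ‖y‖ ^ 2 = 0
  · have hx : x = 0 := by
      rw [← norm_eq_zero, ← sq_eq_zero_iff]; nlinarith [sq_nonneg ‖x‖, sq_nonneg ‖y‖]
    have hy : y = 0 := by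
      rw [← norm_eq_zero, ← sq_eq_zero_iff]; nlinarith [sq_nonneg ‖x‖, sq_nonneg ‖y‖]
    exact ⟨1, K.one_mem, by simp [hx, hy]⟩
  have hpos : 0 < ‖x‖ ^ 2 + ‖y‖ ^ 2 := lt_of_le_of_ne (by positivity) (Ne.symm hxy)
  obtain ⟨h, hh, he⟩ := hrow (t := ‖y‖ ^ 2 / (‖x‖ ^ 2 + ‖y‖ ^ 2))
    ⟨by positivity, (div_le_one hpos).2 (by linarith [sq_nonneg ‖x‖])⟩
  have hr := norm_sq_add_norm_sq_row h p
  have hnorm : ‖h.1 p 0 * x‖ = ‖-(h.1 p 1 * y)‖ := by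
    rw [norm_neg, norm_mul, norm_mul, ← sq_eq_sq₀ (by positivity) (by positivity), mul_pow,
      mul_pow, show ‖h.1 p 1‖ ^ 2 = 1 - ‖h.1 p 0‖ ^ 2 by linarith, he]
    field_simp
    ring
  obtain ⟨θ, hθ⟩ := exists_exp_mul_eq hnorm
  refine ⟨h * ⟨phaseShifter θ 0, phaseShifter_mem_unitaryGroup θ 0⟩, K.mul_mem hh (hK θ), ?_⟩
  have e0 : (h * ⟨phaseShifter θ 0, phaseShifter_mem_unitaryGroup θ 0⟩ :
      unitaryGroup (Fin 2) ℂ).1 p 0 = h.1 p 0 * Complex.exp (θ * Complex.I) := by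
    simp [phaseShifter]
  have e1 : (h * ⟨phaseShifter θ 0, phaseShifter_mem_unitaryGroup θ 0⟩ :
      unitaryGroup (Fin 2) ℂ).1 p 1 = h.1 p 1 := by
    simp [phaseShifter]
  rw [e0, e1]
  linear_combination hθ

end TwoModes

section Elimination

variable {m : ℕ} {H : Subgroup (unitaryGroup (Fin m) ℂ)}

theorem exists_mulVec_eq_zero_on
    (hH : ∀ k j : Fin m, k ≠ j → ∀ v : Fin m → ℂ, ∃ A ∈ H, (A.1 *ᵥ v) j = 0 ∧
      (∀ w : Fin m → ℂ, ∀ l, l ≠ k → l ≠ j → (A.1 *ᵥ w) l = w l) ∧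
      ∀ w : Fin m → ℂ, w k = 0 → w j = 0 → A.1 *ᵥ w = w)
    (k : Fin m) (v : Fin m → ℂ) (R : Finset (Fin m)) (hk : k ∉ R) :
    ∃ V ∈ H, (∀ j ∈ R, (V.1 *ᵥ v) j = 0) ∧
      ∀ w : Fin m → ℂ, (∀ l ∈ insert k R, w l = 0) → V.1 *ᵥ w = w := by
  induction R using Finset.induction_on with
  | empty => exact ⟨1, H.one_mem, by simp, by simp⟩
  | insert j R hj ih =>
    rw [Finset.mem_insert, not_or] at hk
    obtain ⟨V, hV, hV0, hVfix⟩ := ih hk.2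
    obtain ⟨A, hA, hA0, hAl, hAfix⟩ := hH k j hk.1 (V.1 *ᵥ v)
    have hmul (w : Fin m → ℂ) : (A * V).1 *ᵥ w = A.1 *ᵥ (V.1 *ᵥ w) :=
      (mulVec_mulVec w A.1 V.1).symm
    refine ⟨A * V, H.mul_mem hA hV, fun l hl => ?_, fun w hw => ?_⟩
    · rw [hmul]
      rcases Finset.mem_insert.1 hl with rfl | hl
      · exact hA0
      · rw [hAl _ l (fun h => hk.2 (h ▸ hl)) (fun h => hj (h ▸ hl)), hV0 l hl]
    · rw [hmul, hVfix w fun l hl => hw l (by grind)]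
      exact hAfix w (hw k (by simp)) (hw j (by simp))

theorem mem_of_col_eq_outside
    (hphase : ∀ θ k, (⟨phaseShifter θ k, phaseShifter_mem_unitaryGroup θ k⟩ :
      unitaryGroup (Fin m) ℂ) ∈ H)
    (hH : ∀ k j : Fin m, k ≠ j → ∀ v : Fin m → ℂ, ∃ A ∈ H, (A.1 *ᵥ v) j = 0 ∧
      (∀ w : Fin m → ℂ, ∀ l, l ≠ k → l ≠ j → (A.1 *ᵥ w) l = w l) ∧
      ∀ w : Fin m → ℂ, w k = 0 → w j = 0 → A.1 *ᵥ w = w)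
    (S : Finset (Fin m)) (U : unitaryGroup (Fin m) ℂ)
    (hU : ∀ l ∉ S, U.1.col l = Pi.single l 1) : U ∈ H := by
  induction S using Finset.induction_on generalizing U with
  | empty =>
    have : U = 1 := by
      ext x l
      have := congrFun (hU l (by simp)) x
      simpa [Matrix.one_apply, Pi.single_apply] using this
    exact this ▸ H.one_mem
  | insert k S hk ih =>
    obtain ⟨V, hV, hV0, hVfix⟩ := exists_mulVec_eq_zero_on hH k (U.1.col k) S hk
    set W := V * U with hW
    have hcol (l : Fin m) : W.1.col l = V.1 *ᵥ U.1.col l := rfl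
    have hfix (l : Fin m) (hl : l ∉ insert k S) : W.1.col l = Pi.single l 1 := by
      rw [hcol, hU l hl]
      exact hVfix _ fun x hx => Pi.single_eq_of_ne (ne_of_mem_of_not_mem hx hl) _
    have hcols (l : Fin m) : ∑ x, star (W.1 x l) * W.1 x k = (1 : Matrix _ _ ℂ) l k := by
      rw [← mem_unitaryGroup_iff'.1 W.2]
      simp [Matrix.mul_apply, Matrix.star_apply]
    have hzero (x : Fin m) (hx : x ≠ k) : W.1 x k = 0 := by
      by_cases hxS : x ∈ S
      · exact hV0 x hxS
      · have h1 (y : Fin m) : W.1 y x = (Pi.single x 1 : Fin m → ℂ) y :=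
          congrFun (hfix x (by simp [hx, hxS])) y
        have h2 := hcols x
        simpa [h1, Pi.single_apply, Matrix.one_apply, hx, apply_ite] using h2
    have hnorm : ‖(1 : ℂ)‖ = ‖W.1 k k‖ := by
      have h2 := hcols k
      rw [Finset.sum_eq_single k (fun x _ hx => by rw [hzero x hx, mul_zero]) (by simp),
        Matrix.one_apply_eq, Complex.star_def, Complex.conj_mul'] at h2
      have h3 : ‖W.1 k k‖ ^ 2 = 1 := by exact_mod_cast h2
      rw [norm_one, eq_comm, ← sq_eq_sq₀ (norm_nonneg _) zero_le_one, h3, one_pow]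
    obtain ⟨θ, hθ⟩ := exists_exp_mul_eq hnorm.symm
    set P : unitaryGroup (Fin m) ℂ := ⟨phaseShifter θ k, phaseShifter_mem_unitaryGroup θ k⟩
    have hPW (x l : Fin m) : (P * W).1 x l =
        (if x = k then Complex.exp (θ * Complex.I) else 1) * W.1 x l :=
      diagonal_mul _ _ _ _
    have hmem : P * W ∈ H := by
      refine ih _ fun l hl => ?_
      ext x
      rw [Matrix.col_apply, hPW]
      by_cases hlk : l = k
      · subst hlk
        by_cases hx : x = l
        · subst hx; simpa using hθ
        · simp [hzero x hx, hx]
      · have h1 : W.1 x l = (Pi.single l 1 : Fin m → ℂ) x :=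
          congrFun (hfix l (by simp [hlk, hl])) x
        rw [h1]
        by_cases hx : x = l
        · subst hx; simp [hlk]
        · simp [hx]
    rwa [H.mul_mem_cancel_left (hphase θ k), hW, H.mul_mem_cancel_left hV] at hmem

end Elimination

end Helpers

/-- For any nontrivial two-mode gate `g` (a 2×2 unitary with all four
entries nonzero) and any `m ≥ 3`, the closure of the subgroup of `U(m)` generated by all the
`g_{ij}` (`i < j`) together with all phaseshifters contains every m×m special unitary matrix. -/
theorem gate_with_phaseshifters_closure_contains_SUm
    (m : ℕ) (hm : 3 ≤ m)
    (g : Matrix (Fin 2) (Fin 2) ℂ) (hg : g ∈ Matrix.unitaryGroup (Fin 2) ℂ)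
    (hnontriv : ∀ i j : Fin 2, g i j ≠ 0)
    (U : Matrix.unitaryGroup (Fin m) ℂ) (hU : (U : Matrix (Fin m) (Fin m) ℂ).det = 1) :
    U ∈ closure ((Subgroup.closure
        {A : Matrix.unitaryGroup (Fin m) ℂ |
          (∃ i j : Fin m, i < j ∧ (A : Matrix (Fin m) (Fin m) ℂ) = gateOn g i j) ∨
          (∃ (θ : ℝ) (k : Fin m), (A : Matrix (Fin m) (Fin m) ℂ) = phaseShifter θ k)} :
        Subgroup (Matrix.unitaryGroup (Fin m) ℂ)) :
      Set (Matrix.unitaryGroup (Fin m) ℂ)) := by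
  set H := Subgroup.closure
        {A : Matrix.unitaryGroup (Fin m) ℂ |
          (∃ i j : Fin m, i < j ∧ (A : Matrix (Fin m) (Fin m) ℂ) = gateOn g i j) ∨
          (∃ (θ : ℝ) (k : Fin m), (A : Matrix (Fin m) (Fin m) ℂ) = phaseShifter θ k)}
  have hphase (θ : ℝ) (k : Fin m) : (⟨phaseShifter θ k, phaseShifter_mem_unitaryGroup θ k⟩ :
      Matrix.unitaryGroup (Fin m) ℂ) ∈ H :=
    Subgroup.subset_closure (Or.inr ⟨θ, k, rfl⟩)
  have hgate {i j : Fin m} (hij : i < j) (x y : ℂ) (p : Fin 2) :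
      ∃ h : Matrix.unitaryGroup (Fin 2) ℂ,
        gateHom hij.ne h ∈ H ∧ h.1 p 0 * x + h.1 p 1 * y = 0 :=
    exists_mulVec_apply_eq_zero (K := H.comap (gateHom hij.ne))
      (fun θ => by
        have : gateHom hij.ne ⟨phaseShifter θ 0, phaseShifter_mem_unitaryGroup θ 0⟩
            = ⟨phaseShifter θ i, phaseShifter_mem_unitaryGroup θ i⟩ :=
          Subtype.ext (gateOn_phaseShifter_zero θ i j)
        rw [Subgroup.mem_comap, this]
        exact hphase θ i)
      (g := ⟨g, hg⟩) (Subgroup.subset_closure (Or.inl ⟨i, j, hij, rfl⟩)) hnontriv x y p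
  refine subset_closure (mem_of_col_eq_outside hphase (fun k j hkj v => ?_) Finset.univ U
    (by simp))
  rcases hkj.lt_or_gt with hlt | hlt
  · obtain ⟨h, hh, h0⟩ := hgate hlt (v k) (v j) 1
    have hv (w : Fin m → ℂ) := gateOn_mulVec h.1 hlt.ne w
    refine ⟨_, hh, (hv v j).trans ?_, fun w l hk hj => (hv w l).trans ?_,
      fun w hk hj => funext fun l => (hv w l).trans ?_⟩
    · rw [if_neg hkj.symm, if_pos rfl, h0]
    · rw [if_neg hk, if_neg hj]
    · split_ifs <;> simp_all
  · obtain ⟨h, hh, h0⟩ := hgate hlt (v j) (v k) 0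
    have hv (w : Fin m → ℂ) := gateOn_mulVec h.1 hlt.ne w
    refine ⟨_, hh, (hv v j).trans ?_, fun w l hk hj => (hv w l).trans ?_,
      fun w hk hj => funext fun l => (hv w l).trans ?_⟩
    · rw [if_pos rfl, h0]
    · rw [if_neg hj, if_neg hk]
    · split_ifs <;> simp_all
end
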